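/- arXiv:1805.02323 — 2 statements merged into one kernel-verified Lean document; each statement's English description precedes it below -/
import Mathlib

section
/- Lower bound on the weighted sum of the levels: assume δ ∈ (0, δ0/2) is such that for every λ > 0, every maximizer and every i ∈ {1,…,p}, sgn(κ_i)(ψ^λ + Σ_{j=p+1}^k κ_jG(x_j^λ,·)) ≤ c_i^λ everywhere on ∂B_{δ0}(x̄_i). Then there exist C > 0 and λ1 > 0 such that for every λ ≥ λ1 and every maximizer (ω^λ, x_{p+1}^λ, …, x_k^λ), one has Σ_{i=1}^p c_i^λ|κ_i| ≥ −(1/2π)·Σ_{i=1}^p κ_i² ln ε_i − C, where ε_i = (|κ_i|/(πλ))^{1/2}. -/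
open MeasureTheory Metric Real Filter Topology

noncomputable section

abbrev E2 := EuclideanSpace ℝ (Fin 2)

/-- The logarithmic kernel, the fundamental solution of `-Δ` in the plane. -/
def logKer (x y : E2) : ℝ := (1 / (2 * π)) * Real.log (1 / dist x y)

/-- Measurable, essentially bounded functions vanishing outside `K`. -/
structure BddOn (K : Set E2) (f : E2 → ℝ) : Prop where
  meas : Measurable f
  bdd : ∃ C, ∀ᵐ x : E2, |f x| ≤ C
  supp : ∀ x, x ∉ K → f x = 0

namespace BddOn

variable {K L : Set E2} {f g : E2 → ℝ}

lemma mono (hf : BddOn K f) (hKL : K ⊆ L) : BddOn L f :=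
  ⟨hf.meas, hf.bdd, fun x hx => hf.supp x fun h => hx (hKL h)⟩

lemma add (hf : BddOn K f) (hg : BddOn K g) : BddOn K (f + g) := by
  obtain ⟨C, hC⟩ := hf.bdd
  obtain ⟨C', hC'⟩ := hg.bdd
  refine ⟨hf.meas.add hg.meas, ⟨C + C', ?_⟩, fun x hx => by simp [hf.supp x hx, hg.supp x hx]⟩
  filter_upwards [hC, hC'] with x h1 h2
  exact (abs_add_le _ _).trans (add_le_add h1 h2)

lemma const_smul (hf : BddOn K f) (c : ℝ) : BddOn K (c • f) := by
  obtain ⟨C, hC⟩ := hf.bdd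
  refine ⟨hf.meas.const_smul c, ⟨|c| * C, ?_⟩, fun x hx => by simp [hf.supp x hx]⟩
  filter_upwards [hC] with x h1
  rw [Pi.smul_apply, smul_eq_mul, abs_mul]
  gcongr

lemma sum {ι : Type*} (s : Finset ι) {F : ι → E2 → ℝ} (hF : ∀ i ∈ s, BddOn K (F i)) :
    BddOn K (∑ i ∈ s, F i) := by
  classical
  induction s using Finset.induction_on with
  | empty => exact ⟨measurable_const, ⟨0, by simp⟩, by simp⟩
  | insert a s ha ih =>
    rw [Finset.sum_insert ha]
    exact (hF a (by simp)).add (ih fun i hi => hF i (by simp [hi]))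

lemma integrable (hf : BddOn K f) (hK : Bornology.IsBounded K) : Integrable f := by
  obtain ⟨R, hR⟩ := hK.subset_ball 0
  obtain ⟨C, hC⟩ := hf.bdd
  have : IntegrableOn f (ball 0 R) :=
    Measure.integrableOn_of_bounded (M := C) measure_ball_lt_top.ne
      hf.meas.aestronglyMeasurable (ae_restrict_of_ae hC)
  exact (integrableOn_iff_integrable_of_support_subset fun x hx => hR <| by
    by_contra h
    exact hx (hf.supp x h)).1 this

end BddOn

lemma abs_log_one_div_le {d : ℝ} (hd : 0 ≤ d) : |Real.log (1 / d)| ≤ d⁻¹ + d := by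
  rcases hd.eq_or_lt with rfl | hd
  · simp
  have h1 := Real.log_le_sub_one_of_pos hd
  have h2 := Real.log_le_sub_one_of_pos (inv_pos.2 hd)
  rw [Real.log_inv] at h2
  rw [one_div, Real.log_inv, abs_neg, abs_le]
  constructor <;> linarith [inv_pos.2 hd]

lemma integrableOn_inv_norm_ball (R : ℝ) :
    IntegrableOn (fun v : E2 => ‖v‖⁻¹) (ball 0 R) := by
  refine integrableOn_ball_of_norm_le_rpow (C := 1) (α := 1) (by simp) (by simp) ?_
    (by fun_prop)
  refine Eventually.of_forall fun v => ?_
  rw [Real.rpow_neg_one]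
  simp

lemma measurable_log_one_div_norm : Measurable (fun v : E2 => Real.log (1 / ‖v‖)) := by
  fun_prop

lemma integrableOn_log_one_div_norm (R : ℝ) :
    IntegrableOn (fun v : E2 => Real.log (1 / ‖v‖)) (ball 0 R) := by
  have h2 : IntegrableOn (fun v : E2 => ‖v‖) (ball 0 R) :=
    (continuous_norm.continuousOn.integrableOn_compact (isCompact_closedBall 0 R)).mono_set
      ball_subset_closedBall
  refine ((integrableOn_inv_norm_ball R).add h2).mono'
    measurable_log_one_div_norm.aestronglyMeasurable (Eventually.of_forall fun v => ?_)
  exact abs_log_one_div_le (norm_nonneg v)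

lemma BddOn.integrable_comp_sub_mul {K : Set E2} {f : E2 → ℝ} (hf : BddOn K f)
    (hK : Bornology.IsBounded K) {φ : E2 → ℝ} (hφ : ∀ R, IntegrableOn φ (ball 0 R)) (x : E2) :
    Integrable (fun y => φ (x - y) * f y) := by
  obtain ⟨R, hR⟩ := hK.subset_ball x
  obtain ⟨C, hC⟩ := hf.bdd
  have h1 : Integrable ((ball (0 : E2) R).indicator φ) :=
    (hφ R).integrable_indicator measurableSet_ball
  have h2 := (h1.comp_sub_left x).mul_bdd hf.meas.aestronglyMeasurable hC
  refine h2.congr (Eventually.of_forall fun y => ?_)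
  by_cases hy : y ∈ K
  · have : x - y ∈ ball (0 : E2) R := by
      have := hR hy
      rwa [mem_ball_zero_iff, ← dist_eq_norm, dist_comm]
    simp [Set.indicator_of_mem this]
  · simp [hf.supp y hy]

lemma BddOn.integrable_logKer_mul {K : Set E2} {f : E2 → ℝ} (hf : BddOn K f)
    (hK : Bornology.IsBounded K) (x : E2) : Integrable (fun y => logKer x y * f y) := by
  refine ((hf.integrable_comp_sub_mul hK integrableOn_log_one_div_norm x).const_mul
    (1 / (2 * π))).congr (Eventually.of_forall fun y => ?_)
  simp only [logKer, dist_eq_norm]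
  ring

lemma BddOn.integrable_logKer_mul_mul {K : Set E2} {f g : E2 → ℝ} (hf : BddOn K f)
    (hg : BddOn K g) (hK : Bornology.IsBounded K) :
    Integrable (fun q : E2 × E2 => logKer q.1 q.2 * f q.1 * g q.2)
      ((volume : Measure E2).prod volume) := by
  obtain ⟨R, hR⟩ := hK.subset_ball 0
  obtain ⟨C, hC⟩ := hf.bdd
  have h1 : Integrable ((ball (0 : E2) (R + R)).indicator (fun v : E2 => Real.log (1 / ‖v‖))) :=
    (integrableOn_log_one_div_norm (R + R)).integrable_indicator measurableSet_ball
  have h2 := (hg.integrable hK).convolution_integrand (ContinuousLinearMap.mul ℝ ℝ) h1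
  have h3 := (h2.mul_bdd (g := fun q : E2 × E2 => f q.1)
    (hf.meas.comp measurable_fst).aestronglyMeasurable
    (Measure.quasiMeasurePreserving_fst.ae hC)).const_mul (1 / (2 * π))
  refine h3.congr (Eventually.of_forall fun q => ?_)
  by_cases hx : q.1 ∈ K
  · by_cases hy : q.2 ∈ K
    · have : q.1 - q.2 ∈ ball (0 : E2) (R + R) := by
        rw [mem_ball_zero_iff]
        have h1 := hR hx
        have h2 := hR hy
        rw [mem_ball_zero_iff] at h1 h2
        exact (norm_sub_le _ _).trans_lt (add_lt_add h1 h2)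
      simp only [ContinuousLinearMap.mul_apply', Set.indicator_of_mem this, logKer, dist_eq_norm]
      ring
    · simp [hg.supp _ hy]
  · simp [hf.supp _ hx]

lemma setIntegral_ball_inv_norm {r : ℝ} (hr : 0 < r) :
    ∫ v in ball (0 : E2) r, ‖v‖⁻¹ = r * ∫ v in ball (0 : E2) 1, ‖v‖⁻¹ := by
  have h := Measure.setIntegral_comp_smul_of_pos (volume : Measure E2) (fun v => ‖v‖⁻¹)
    (ball 0 1) hr
  rw [_root_.smul_ball hr.ne', smul_zero, mul_one, Real.norm_of_nonneg hr.le] at h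
  simp only [norm_smul, Real.norm_of_nonneg hr.le, mul_inv, finrank_euclideanSpace,
    Fintype.card_fin, integral_const_mul, smul_eq_mul] at h
  field_simp at h
  simp only [one_div] at h
  exact h.symm

lemma integral_inv_norm_mul_le {u : E2 → ℝ} {lam r : ℝ} (hr : 0 < r)
    (hu : Integrable u) (hu0 : ∀ᵐ x, 0 ≤ u x) (hu1 : ∀ᵐ x, u x ≤ lam)
    (x : E2) :
    Integrable (fun y => ‖x - y‖⁻¹ * u y) ∧
    ∫ y, ‖x - y‖⁻¹ * u y ≤ lam * (r * ∫ v in ball (0 : E2) 1, ‖v‖⁻¹) + r⁻¹ * ∫ y, u y := by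
  have h1 : Integrable ((ball (0 : E2) r).indicator (fun v : E2 => ‖v‖⁻¹)) :=
    (integrableOn_inv_norm_ball r).integrable_indicator measurableSet_ball
  have h2 := (h1.comp_sub_left x).const_mul lam
  have h3 := h2.add (hu.const_mul r⁻¹)
  have hle : ∀ᵐ y, ‖x - y‖⁻¹ * u y ≤
      lam * (ball (0 : E2) r).indicator (fun v : E2 => ‖v‖⁻¹) (x - y) + r⁻¹ * u y := by
    filter_upwards [hu0, hu1] with y h0 h1
    by_cases hy : x - y ∈ ball (0 : E2) r
    · rw [Set.indicator_of_mem hy]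
      have : ‖x - y‖⁻¹ * u y ≤ ‖x - y‖⁻¹ * lam := by gcongr
      nlinarith [mul_nonneg (inv_pos.2 hr).le h0]
    · rw [Set.indicator_of_notMem hy, mul_zero, zero_add]
      rw [mem_ball_zero_iff, not_lt] at hy
      gcongr
  have hint : Integrable (fun y => ‖x - y‖⁻¹ * u y) := by
    refine h3.mono' ?_ ?_
    · exact (by fun_prop : Measurable fun y : E2 => ‖x - y‖⁻¹).aestronglyMeasurable.mul
        hu.aestronglyMeasurable
    · filter_upwards [hle, hu0] with y hy h0
      rw [Real.norm_of_nonneg (by positivity)]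
      exact hy
  refine ⟨hint, (integral_mono_ae hint h3 hle).trans ?_⟩
  simp only [Pi.add_apply]
  rw [integral_add h2 (hu.const_mul r⁻¹), integral_const_mul, integral_const_mul,
    integral_sub_left_eq_self (fun v => (ball (0 : E2) r).indicator (fun v : E2 => ‖v‖⁻¹) v) volume,
    integral_indicator measurableSet_ball, setIntegral_ball_inv_norm hr]

/-- The logarithmic potential of a density bounded by `lam` varies by a bounded amount
on the scale at which that density concentrates. -/
lemma integral_logKer_mul_ge {K : Set E2} (hK : Bornology.IsBounded K) {u : E2 → ℝ} {lam r : ℝ}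
    (hr : 0 < r) (hu : BddOn K u) (hu0 : ∀ᵐ x, 0 ≤ u x)
    (hu1 : ∀ᵐ x, u x ≤ lam) {x y : E2} (hxy : dist x y ≤ 4 * r) :
    (∫ w, logKer x w * u w) - (1 / (2 * π)) * (4 * r) *
      (lam * (r * ∫ v in ball (0 : E2) 1, ‖v‖⁻¹) + r⁻¹ * ∫ y, u y) ≤ ∫ w, logKer y w * u w := by
  obtain ⟨hint, hle⟩ := integral_inv_norm_mul_le hr (hu.integrable hK) hu0 hu1 x
  have hpi : (0 : ℝ) ≤ 1 / (2 * π) := by positivity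
  have h1 : (∫ w, logKer x w * u w) ≤
      ∫ w, (logKer y w * u w + (1 / (2 * π)) * (4 * r) * (‖x - w‖⁻¹ * u w)) := by
    refine integral_mono_ae (hu.integrable_logKer_mul hK x)
      ((hu.integrable_logKer_mul hK y).add (hint.const_mul _)) ?_
    have hne : ∀ z : E2, ∀ᵐ w : E2, w ≠ z := fun z => by
      simp [ae_iff]
    filter_upwards [hu0, hne x, hne y] with w h0 hwx hwy
    have hdx : 0 < dist x w := dist_pos.2 hwx.symm
    have hdy : 0 < dist y w := dist_pos.2 hwy.symm
    have key : Real.log (1 / dist x w) ≤ Real.log (1 / dist y w) + 4 * r * ‖x - w‖⁻¹ := by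
      rw [← dist_eq_norm, one_div, one_div, Real.log_inv, Real.log_inv]
      have h2 : dist y w ≤ dist x w * (1 + 4 * r * (dist x w)⁻¹) := by
        have := dist_triangle y x w
        rw [dist_comm y x] at this
        field_simp
        linarith
      have h3 := Real.log_le_log hdy h2
      have hpos : 0 < 1 + 4 * r * (dist x w)⁻¹ := by positivity
      rw [Real.log_mul hdx.ne' hpos.ne'] at h3
      linarith [Real.log_le_sub_one_of_pos hpos]
    have := mul_le_mul_of_nonneg_left key (mul_nonneg hpi h0)
    simp only [logKer]
    nlinarith
  rw [integral_add (hu.integrable_logKer_mul hK y) (hint.const_mul _), integral_const_mul] at h1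
  have := mul_le_mul_of_nonneg_left hle (by positivity : 0 ≤ 1 / (2 * π) * (4 * r))
  linarith

lemma le_essInf_restrict {Φ : E2 → ℝ} {S : Set E2} {a : ℝ} (hS : volume S ≠ 0)
    (ha : ∀ᵐ x ∂(volume.restrict S), a ≤ Φ x) : a ≤ essInf Φ (volume.restrict S) := by
  have hne : (ae (volume.restrict S)).NeBot := by
    rw [ae_neBot]
    exact fun h => hS (Measure.restrict_eq_zero.1 h)
  have hfr : ∃ n : ℕ, ∃ᶠ x in ae (volume.restrict S), Φ x ≤ n := by
    by_contra! hcon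
    have hall : ∀ᵐ x ∂(volume.restrict S), ∀ n : ℕ, (n : ℝ) < Φ x := ae_all_iff.2 hcon
    obtain ⟨x, hx⟩ := hall.exists
    obtain ⟨n, hn⟩ := exists_nat_ge (Φ x)
    exact hn.not_gt (hx n)
  obtain ⟨n, hn⟩ := hfr
  exact le_liminf_of_le (IsCoboundedUnder.of_frequently_le hn) ha

/-- If `u` maximizes the linear functional `∫ Φ u` to first order among densities between
`0` and `lam` of prescribed mass, then `Φ` is larger on the support of `u` than on any set
which `u` does not saturate. -/
lemma ae_le_of_first_variation {c : E2} {δ lam a : ℝ} {u Φ : E2 → ℝ} {B : Set E2}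
    (hu : BddOn (ball c δ) u) (hu1 : ∀ᵐ x, u x ≤ lam)
    (hΦ : ∀ g, BddOn (ball c δ) g → Integrable (fun x => Φ x * g x))
    (hvar : ∀ η, BddOn (ball c δ) η → ∫ x, η x = 0 →
      (∃ t0 > 0, ∀ t, 0 < t → t ≤ t0 → ∀ x, 0 ≤ u x → u x ≤ lam →
        0 ≤ u x + t * η x ∧ u x + t * η x ≤ lam) → ∫ x, Φ x * η x ≤ 0)
    (hB : MeasurableSet B) (hBsub : B ⊆ ball c δ) (hα : 0 < ∫ x in B, (lam - u x))
    (ha : ∀ x ∈ B, a ≤ Φ x) : ∀ᵐ x, 0 < u x → a ≤ Φ x := by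
  obtain ⟨C, hC⟩ := hu.bdd
  have hone : BddOn (ball c δ) ((ball c δ).indicator 1) :=
    ⟨measurable_one.indicator measurableSet_ball, ⟨1, Eventually.of_forall fun x => by
      by_cases hx : x ∈ ball c δ <;> simp [hx]⟩, fun x hx => by simp [hx]⟩
  have hmk := (hΦ _ hone).aestronglyMeasurable
  set A : Set E2 := {x | 0 < u x ∧ hmk.mk _ x < a} with hAdef
  have hA : MeasurableSet A :=
    (measurableSet_lt measurable_const hu.meas).inter
      (measurableSet_lt hmk.stronglyMeasurable_mk.measurable measurable_const)
  have hAball : ∀ x ∈ A, x ∈ ball c δ := fun x hx => by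
    by_contra h
    exact hx.1.ne' (hu.supp x h)
  have hAΦ : ∀ᵐ x, x ∈ A → Φ x < a := by
    filter_upwards [hmk.ae_eq_mk] with x hx hxA
    have := hxA.2
    rw [← hx, Set.indicator_of_mem (hAball x hxA)] at this
    simpa using this
  by_contra hcon
  have hApos : 0 < volume A := by
    rw [pos_iff_ne_zero]
    intro h0
    refine hcon ?_
    have h0' : ∀ᵐ x, x ∉ A := measure_eq_zero_iff_ae_notMem.1 h0
    filter_upwards [h0', hmk.ae_eq_mk] with x hx1 hx2 hpos
    have hxb : x ∈ ball c δ := by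
      by_contra h
      exact hpos.ne' (hu.supp x h)
    by_contra! hlt
    refine hx1 ⟨hpos, ?_⟩
    rw [← hx2, Set.indicator_of_mem hxb]
    simpa using hlt
  set f₁ : E2 → ℝ := B.indicator (fun x => lam - u x) with hf₁
  set f₂ : E2 → ℝ := A.indicator u with hf₂
  have hb₁ : BddOn (ball c δ) f₁ := by
    refine ⟨(measurable_const.sub hu.meas).indicator hB, ⟨|lam| + C, ?_⟩, fun x hx =>
      Set.indicator_of_notMem (fun h => hx (hBsub h)) _⟩
    filter_upwards [hC] with x hx
    have h3 : 0 ≤ |u x| := abs_nonneg _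
    by_cases hxB : x ∈ B
    · rw [hf₁, Set.indicator_of_mem hxB]
      exact (abs_sub _ _).trans (by linarith)
    · rw [hf₁, Set.indicator_of_notMem hxB, abs_zero]
      positivity [h3.trans hx]
  have hb₂ : BddOn (ball c δ) f₂ := by
    refine ⟨hu.meas.indicator hA, ⟨C, ?_⟩, fun x hx =>
      Set.indicator_of_notMem (fun h => hx (hAball x h)) _⟩
    filter_upwards [hC] with x hx
    by_cases hxA : x ∈ A
    · rwa [hf₂, Set.indicator_of_mem hxA]
    · rw [hf₂, Set.indicator_of_notMem hxA, abs_zero]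
      exact (abs_nonneg _).trans hx
  have hi₁ := hb₁.integrable isBounded_ball
  have hi₂ := hb₂.integrable isBounded_ball
  have hΦ₁ := hΦ _ hb₁
  have hΦ₂ := hΦ _ hb₂
  set α := ∫ x, f₁ x with hαdef
  set β := ∫ x, f₂ x with hβdef
  have hα' : 0 < α := by rwa [hαdef, hf₁, integral_indicator hB]
  have hβ : 0 < β := by
    rw [hβdef, integral_pos_iff_support_of_nonneg_ae _ hi₂]
    · refine hApos.trans_le (measure_mono fun x hx => ?_)
      rw [Function.mem_support, hf₂, Set.indicator_of_mem hx]
      exact hx.1.ne'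
    · exact Eventually.of_forall fun x => Set.indicator_nonneg (fun y hy => hy.1.le) x
  have h₁ : a * α ≤ ∫ x, Φ x * f₁ x := by
    rw [hαdef, ← integral_const_mul]
    refine integral_mono_ae (hi₁.const_mul a) hΦ₁ ?_
    filter_upwards [hu1] with x hx
    by_cases hxB : x ∈ B
    · simp only [hf₁, Set.indicator_of_mem hxB]
      exact mul_le_mul_of_nonneg_right (ha x hxB) (by linarith)
    · simp [hf₁, Set.indicator_of_notMem hxB]
  have h₂ : ∫ x, Φ x * f₂ x < a * β := by
    have hpos : 0 < ∫ x, (a * f₂ x - Φ x * f₂ x) := by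
      have hint : Integrable (fun x => a * f₂ x - Φ x * f₂ x) := (hi₂.const_mul a).sub hΦ₂
      rw [integral_pos_iff_support_of_nonneg_ae _ hint]
      · have hsub : A ≤ᵐ[volume] Function.support (fun x => a * f₂ x - Φ x * f₂ x) := by
          filter_upwards [hAΦ] with x hx (hxA : x ∈ A)
          show a * f₂ x - Φ x * f₂ x ≠ 0
          rw [hf₂, Set.indicator_of_mem hxA, ← sub_mul]
          exact (mul_pos (sub_pos.2 (hx hxA)) hxA.1).ne'
        exact hApos.trans_le (measure_mono_ae hsub)
      · filter_upwards [hAΦ] with x hx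
        show 0 ≤ a * f₂ x - Φ x * f₂ x
        by_cases hxA : x ∈ A
        · rw [hf₂, Set.indicator_of_mem hxA, ← sub_mul]
          exact (mul_pos (sub_pos.2 (hx hxA)) hxA.1).le
        · simp [hf₂, Set.indicator_of_notMem hxA]
    rw [integral_sub (hi₂.const_mul a) hΦ₂, integral_const_mul] at hpos
    linarith
  have hη := hvar (β • f₁ + (-α) • f₂) ((hb₁.const_smul _).add (hb₂.const_smul _)) ?_ ?_
  · have heq : ∫ x, Φ x * (β • f₁ + (-α) • f₂) x =
        β * (∫ x, Φ x * f₁ x) - α * ∫ x, Φ x * f₂ x := by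
      rw [← integral_const_mul, ← integral_const_mul,
        ← integral_sub (hΦ₁.const_mul _) (hΦ₂.const_mul _)]
      refine integral_congr_ae (Eventually.of_forall fun x => ?_)
      simp only [Pi.add_apply, Pi.smul_apply, smul_eq_mul]
      ring
    rw [heq] at hη
    nlinarith [mul_le_mul_of_nonneg_left h₁ hβ.le, mul_lt_mul_of_pos_left h₂ hα']
  · simp only [Pi.add_apply, Pi.smul_apply, smul_eq_mul]
    rw [integral_add (hi₁.const_mul _) (hi₂.const_mul _), integral_const_mul,
      integral_const_mul, ← hαdef, ← hβdef]
    ring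
  · refine ⟨1 / (α + β), by positivity, fun t ht ht' x hx0 hx1 => ?_⟩
    rw [le_div_iff₀ (by positivity)] at ht'
    have htα : t * α ≤ 1 := by nlinarith
    have htβ : t * β ≤ 1 := by nlinarith
    have hf1 : 0 ≤ f₁ x ∧ f₁ x ≤ lam - u x := by
      by_cases hxB : x ∈ B
      · simp [hf₁, Set.indicator_of_mem hxB, hx1]
      · simp [hf₁, Set.indicator_of_notMem hxB, hx1]
    have hf2 : 0 ≤ f₂ x ∧ f₂ x ≤ u x := by
      by_cases hxA : x ∈ A
      · simp [hf₂, Set.indicator_of_mem hxA, hx0]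
      · simp [hf₂, Set.indicator_of_notMem hxA, hx0]
    have e1 : t * β * f₁ x ≤ f₁ x := mul_le_of_le_one_left hf1.1 htβ
    have e2 : t * α * f₂ x ≤ f₂ x := mul_le_of_le_one_left hf2.1 htα
    have e3 : 0 ≤ t * β * f₁ x := mul_nonneg (by positivity) hf1.1
    have e4 : 0 ≤ t * α * f₂ x := mul_nonneg (by positivity) hf2.1
    have e5 : t * (β • f₁ + (-α) • f₂) x = t * β * f₁ x - t * α * f₂ x := by
      simp only [Pi.add_apply, Pi.smul_apply, smul_eq_mul]
      ring
    rw [e5]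
    constructor <;> linarith

/-- The potential generated in `D` by the density `f`. -/
def potential (D : Set E2) (G : E2 → E2 → ℝ) (f : E2 → ℝ) (x : E2) : ℝ :=
  ∫ y in D, G x y * f y

/-- The kinetic energy in `D` of the density `f`. -/
def energy (D : Set E2) (G : E2 → E2 → ℝ) (f : E2 → ℝ) : ℝ :=
  (1 / 2) * ∫ x in D, ∫ y in D, G x y * f x * f y

/-- The interaction of the densities `f` and `g` through the kernel `k`. -/
def interaction (D : Set E2) (k : E2 → E2 → ℝ) (f g : E2 → ℝ) : ℝ :=
  ∫ q : E2 × E2, k q.1 q.2 * f q.1 * g q.2 ∂((volume.restrict D).prod (volume.restrict D))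

/-- `G` is the logarithmic kernel minus a continuous symmetric regular part `h`, with `h` bounded
by `M` on `K`, and `G` bounded by `M` on pairs of points of `K` at distance at least `r`. -/
structure IsGreenOn (D : Set E2) (h G : E2 → E2 → ℝ) (K : Set E2) (M r : ℝ) : Prop where
  isOpen : IsOpen D
  subset : K ⊆ D
  bounded : Bornology.IsBounded K
  cont : ContinuousOn (fun q : E2 × E2 => h q.1 q.2) (D ×ˢ D)
  symm : ∀ x ∈ D, ∀ y ∈ D, h x y = h y x
  eq : ∀ x y, G x y = logKer x y - h x y
  abs_reg_le : ∀ x ∈ K, ∀ y ∈ K, |h x y| ≤ M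
  abs_le : ∀ x ∈ K, ∀ y ∈ K, r ≤ dist x y → |G x y| ≤ M

lemma abs_interaction_le {D : Set E2} {k : E2 → E2 → ℝ} {f g : E2 → ℝ} {M : ℝ}
    (hf : Integrable f) (hg : Integrable g)
    (hk : ∀ x y, f x ≠ 0 → g y ≠ 0 → |k x y| ≤ M) :
    |interaction D k f g| ≤ M * ((∫ x in D, |f x|) * ∫ x in D, |g x|) := by
  rw [← integral_prod_mul, ← integral_const_mul, ← Real.norm_eq_abs]
  refine norm_integral_le_of_norm_le ((hf.abs.restrict.mul_prod hg.abs.restrict).const_mul M)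
    (Eventually.of_forall fun q => ?_)
  rw [Real.norm_eq_abs, abs_mul, abs_mul, mul_assoc]
  by_cases h1 : f q.1 = 0
  · simp [h1]
  by_cases h2 : g q.2 = 0
  · simp [h2]
  exact mul_le_mul_of_nonneg_right (hk _ _ h1 h2) (by positivity)

lemma abs_potential_le {D : Set E2} {k : E2 → E2 → ℝ} {f : E2 → ℝ} {M : ℝ} {x : E2}
    (hf : Integrable f) (hk : ∀ y, f y ≠ 0 → |k x y| ≤ M) :
    |potential D k f x| ≤ M * ∫ x in D, |f x| := by
  rw [← integral_const_mul, ← Real.norm_eq_abs]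
  refine norm_integral_le_of_norm_le (hf.abs.restrict.const_mul M)
    (Eventually.of_forall fun y => ?_)
  rw [Real.norm_eq_abs, abs_mul]
  by_cases h1 : f y = 0
  · simp [h1]
  exact mul_le_mul_of_nonneg_right (hk _ h1) (by positivity)

lemma BddOn.integrable_logKer_prod {K D : Set E2} {f g : E2 → ℝ} (hf : BddOn K f)
    (hg : BddOn K g) (hK : Bornology.IsBounded K) :
    Integrable (fun q : E2 × E2 => logKer q.1 q.2 * f q.1 * g q.2)
      ((volume.restrict D).prod (volume.restrict D)) := by
  rw [Measure.prod_restrict]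
  exact (hf.integrable_logKer_mul_mul hg hK).restrict

namespace IsGreenOn

variable {D K : Set E2} {h G : E2 → E2 → ℝ} {M r : ℝ} {f g : E2 → ℝ}

lemma integrable_reg_prod (hGr : IsGreenOn D h G K M r) (hf : BddOn K f) (hg : BddOn K g) :
    Integrable (fun q : E2 × E2 => h q.1 q.2 * f q.1 * g q.2)
      ((volume.restrict D).prod (volume.restrict D)) := by
  have hfi := (hf.integrable hGr.bounded).restrict (s := D)
  have hgi := (hg.integrable hGr.bounded).restrict (s := D)
  have hh : AEStronglyMeasurable (fun q : E2 × E2 => h q.1 q.2)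
      ((volume.restrict D).prod (volume.restrict D)) := by
    rw [Measure.prod_restrict]
    exact hGr.cont.aestronglyMeasurable
      (hGr.isOpen.measurableSet.prod hGr.isOpen.measurableSet)
  refine ((hfi.abs.mul_prod hgi.abs).const_mul M).mono'
    ((hh.mul (hf.meas.comp measurable_fst).aestronglyMeasurable).mul
      (hg.meas.comp measurable_snd).aestronglyMeasurable) (Eventually.of_forall fun q => ?_)
  rw [Real.norm_eq_abs, abs_mul, abs_mul, mul_assoc]
  by_cases h1 : q.1 ∈ K
  · by_cases h2 : q.2 ∈ K
    · exact mul_le_mul_of_nonneg_right (hGr.abs_reg_le _ h1 _ h2) (by positivity)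
    · simp [hg.supp _ h2]
  · simp [hf.supp _ h1]

lemma integrable_prod (hGr : IsGreenOn D h G K M r) (hf : BddOn K f) (hg : BddOn K g) :
    Integrable (fun q : E2 × E2 => G q.1 q.2 * f q.1 * g q.2)
      ((volume.restrict D).prod (volume.restrict D)) := by
  refine ((hf.integrable_logKer_prod hg hGr.bounded).sub
    (hGr.integrable_reg_prod hf hg)).congr (Eventually.of_forall fun q => ?_)
  simp only [hGr.eq, Pi.sub_apply]
  ring

lemma integrable_reg (hGr : IsGreenOn D h G K M r) (hf : BddOn K f) {x : E2} (hx : x ∈ K) :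
    Integrable (fun y => h x y * f y) (volume.restrict D) := by
  have hfi := (hf.integrable hGr.bounded).restrict (s := D)
  have hh : AEStronglyMeasurable (fun y => h x y) (volume.restrict D) := by
    refine ContinuousOn.aestronglyMeasurable ?_ hGr.isOpen.measurableSet
    exact hGr.cont.comp (f := fun y : E2 => (x, y)) (by fun_prop)
      fun y hy => ⟨hGr.subset hx, hy⟩
  refine (hfi.abs.const_mul M).mono' (hh.mul hf.meas.aestronglyMeasurable)
    (Eventually.of_forall fun y => ?_)
  rw [Real.norm_eq_abs, abs_mul]
  by_cases h2 : y ∈ K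
  · exact mul_le_mul_of_nonneg_right (hGr.abs_reg_le _ hx _ h2) (by positivity)
  · simp [hf.supp _ h2]

lemma integrable (hGr : IsGreenOn D h G K M r) (hf : BddOn K f) {x : E2} (hx : x ∈ K) :
    Integrable (fun y => G x y * f y) (volume.restrict D) := by
  refine ((hf.integrable_logKer_mul hGr.bounded x).restrict.sub
    (hGr.integrable_reg hf hx)).congr (Eventually.of_forall fun q => ?_)
  simp only [hGr.eq, Pi.sub_apply]
  ring

lemma kernel_symm (hGr : IsGreenOn D h G K M r) {x y : E2} (hx : x ∈ D) (hy : y ∈ D) :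
    G x y = G y x := by
  rw [hGr.eq, hGr.eq, hGr.symm x hx y hy, logKer, logKer, dist_comm]

lemma potential_eq (hGr : IsGreenOn D h G K M r) (hf : BddOn K f) {x : E2} (hx : x ∈ K) :
    potential D G f x = (∫ y, logKer x y * f y) - potential D h f x := by
  rw [← setIntegral_eq_integral_of_forall_compl_eq_zero (s := D), potential, potential,
    ← integral_sub (hf.integrable_logKer_mul hGr.bounded x).restrict (hGr.integrable_reg hf hx)]
  · simp only [hGr.eq, sub_mul]
  · intro y hy
    rw [hf.supp y fun h => hy (hGr.subset h), mul_zero]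

lemma potential_add_smul (hGr : IsGreenOn D h G K M r) (hf : BddOn K f) (hg : BddOn K g)
    (t : ℝ) {x : E2} (hx : x ∈ K) :
    potential D G (f + t • g) x = potential D G f x + t * potential D G g x := by
  simp only [potential]
  rw [← integral_const_mul, ← integral_add (hGr.integrable hf hx)
    ((hGr.integrable hg hx).const_mul t)]
  refine integral_congr_ae (Eventually.of_forall fun y => ?_)
  simp only [Pi.add_apply, Pi.smul_apply, smul_eq_mul]
  ring

lemma potential_sum (hGr : IsGreenOn D h G K M r) {ι : Type*} (s : Finset ι) {F : ι → E2 → ℝ}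
    (hF : ∀ i ∈ s, BddOn K (F i)) {x : E2} (hx : x ∈ K) :
    potential D G (∑ i ∈ s, F i) x = ∑ i ∈ s, potential D G (F i) x := by
  simp only [potential]
  rw [← integral_finsetSum _ fun i hi => hGr.integrable (hF i hi) hx]
  simp only [Finset.sum_apply, Finset.mul_sum]

lemma energy_eq (hGr : IsGreenOn D h G K M r) (hf : BddOn K f) :
    energy D G f = (1 / 2) * interaction D G f f := by
  rw [energy, interaction, integral_prod _ (hGr.integrable_prod hf hf)]

lemma integrable_potential_mul (hGr : IsGreenOn D h G K M r) (hf : BddOn K f)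
    (hg : BddOn K g) :
    Integrable (fun x => potential D G f x * g x) (volume.restrict D) := by
  refine (hGr.integrable_prod hg hf).integral_prod_left.congr
    (Eventually.of_forall fun x => ?_)
  simp only [potential]
  rw [← integral_mul_const]
  congr 1 with y
  ring

lemma interaction_eq (hGr : IsGreenOn D h G K M r) (hf : BddOn K f) (hg : BddOn K g) :
    interaction D G g f = ∫ x in D, potential D G f x * g x := by
  rw [interaction, integral_prod _ (hGr.integrable_prod hg hf)]
  congr 1 with x
  simp only [potential]
  rw [← integral_mul_const]
  congr 1 with y
  ring

lemma interaction_comm (hGr : IsGreenOn D h G K M r) (hf : BddOn K f) (hg : BddOn K g) :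
    interaction D G f g = interaction D G g f := by
  rw [interaction, interaction, ← integral_prod_swap]
  refine integral_congr_ae (Eventually.of_forall fun q => ?_)
  simp only [Prod.fst_swap, Prod.snd_swap]
  by_cases h1 : q.1 ∈ K
  · by_cases h2 : q.2 ∈ K
    · rw [hGr.kernel_symm (hGr.subset h2) (hGr.subset h1)]
      ring
    · simp [hf.supp _ h2]
  · simp [hg.supp _ h1]

lemma energy_add_smul (hGr : IsGreenOn D h G K M r) (hf : BddOn K f) (hg : BddOn K g) (t : ℝ) :
    energy D G (f + t • g) =
      energy D G f + t * (∫ x in D, potential D G f x * g x) + t ^ 2 * energy D G g := by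
  rw [hGr.energy_eq (hf.add (hg.const_smul t)), hGr.energy_eq hf, hGr.energy_eq hg,
    ← hGr.interaction_eq hf hg]
  have hexp : interaction D G (f + t • g) (f + t • g) = interaction D G f f +
      t * interaction D G f g + t * interaction D G g f + t ^ 2 * interaction D G g g := by
    simp only [interaction]
    have iff' := hGr.integrable_prod hf hf
    have ifg := (hGr.integrable_prod hf hg).const_mul t
    have igf := (hGr.integrable_prod hg hf).const_mul t
    have igg := (hGr.integrable_prod hg hg).const_mul (t ^ 2)
    rw [← integral_const_mul, ← integral_const_mul, ← integral_const_mul,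
      ← integral_add' iff' ifg, ← integral_add' (iff'.add ifg) igf,
      ← integral_add' ((iff'.add ifg).add igf) igg]
    refine integral_congr_ae (Eventually.of_forall fun q => ?_)
    simp only [Pi.add_apply, Pi.smul_apply, smul_eq_mul]
    ring
  rw [hexp, hGr.interaction_comm hf hg]
  ring

lemma interaction_sum (hGr : IsGreenOn D h G K M r) {ι : Type*} [Fintype ι] {F : ι → E2 → ℝ}
    (hF : ∀ i, BddOn K (F i)) :
    interaction D G (∑ i, F i) (∑ i, F i) = ∑ i, ∑ j, interaction D G (F i) (F j) := by
  simp only [interaction]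
  rw [← Finset.sum_congr rfl fun i _ =>
    integral_finsetSum _ fun j _ => hGr.integrable_prod (hF i) (hF j),
    ← integral_finsetSum _ fun i _ =>
      integrable_finsetSum _ fun j _ => hGr.integrable_prod (hF i) (hF j)]
  refine integral_congr_ae (Eventually.of_forall fun q => ?_)
  simp only [Finset.sum_apply]
  rw [mul_assoc, Finset.sum_mul_sum, Finset.mul_sum]
  refine Finset.sum_congr rfl fun i _ => ?_
  rw [Finset.mul_sum]
  exact Finset.sum_congr rfl fun j _ => by ring

/-- Up to a bounded error, the energy of a sum of well separated densities is the sum of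
their logarithmic self-interactions. -/
lemma abs_energy_sum_sub_le (hGr : IsGreenOn D h G K M r) {ι : Type*} [Fintype ι]
    [DecidableEq ι] {F : ι → E2 → ℝ} {a : ι → ℝ} (hM : 0 ≤ M) (hF : ∀ i, BddOn K (F i))
    (hmass : ∀ i, ∫ x in D, |F i x| ≤ a i)
    (hsep : ∀ i j, i ≠ j → ∀ x y, F i x ≠ 0 → F j y ≠ 0 → r ≤ dist x y) :
    |energy D G (∑ i, F i) - (1 / 2) * ∑ i, interaction D logKer (F i) (F i)| ≤
      (1 / 2) * (M * (∑ i, a i) ^ 2) := by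
  have hK : ∀ i x, F i x ≠ 0 → x ∈ K := fun i x hx => by
    by_contra h
    exact hx ((hF i).supp x h)
  have hint := fun i => (hF i).integrable hGr.bounded
  have hbd : ∀ i j, |interaction D G (F i) (F j) -
      (if i = j then interaction D logKer (F i) (F j) else 0)| ≤ M * (a i * a j) := by
    intro i j
    have hij : M * ((∫ x in D, |F i x|) * ∫ x in D, |F j x|) ≤ M * (a i * a j) := by
      have h1 : 0 ≤ ∫ x in D, |F j x| := integral_nonneg fun _ => abs_nonneg _
      have h2 : 0 ≤ ∫ x in D, |F i x| := integral_nonneg fun _ => abs_nonneg _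
      have := hmass i
      have := hmass j
      gcongr
      exact h2.trans (hmass i)
    refine le_trans ?_ hij
    by_cases h : i = j
    · subst h
      rw [if_pos rfl]
      have : interaction D G (F i) (F i) - interaction D logKer (F i) (F i) =
          -interaction D h (F i) (F i) := by
        simp only [interaction]
        rw [← integral_sub (hGr.integrable_prod (hF i) (hF i))
          ((hF i).integrable_logKer_prod (hF i) hGr.bounded), ← integral_neg]
        refine integral_congr_ae (Eventually.of_forall fun q => ?_)
        simp only [hGr.eq]
        ring
      rw [this, abs_neg]
      exact abs_interaction_le (hint i) (hint i) fun x y hx hy =>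
        hGr.abs_reg_le x (hK i x hx) y (hK i y hy)
    · rw [if_neg h, sub_zero]
      exact abs_interaction_le (hint i) (hint j) fun x y hx hy =>
        hGr.abs_le x (hK i x hx) y (hK j y hy) (hsep i j h x y hx hy)
  have hsum : energy D G (∑ i, F i) - (1 / 2) * ∑ i, interaction D logKer (F i) (F i) =
      (1 / 2) * ∑ i, ∑ j, (interaction D G (F i) (F j) -
        (if i = j then interaction D logKer (F i) (F j) else 0)) := by
    rw [hGr.energy_eq (BddOn.sum _ fun i _ => hF i), hGr.interaction_sum hF]
    simp only [Finset.sum_sub_distrib, Finset.sum_ite_eq, Finset.mem_univ, if_true]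
    ring
  rw [hsum, abs_mul, abs_of_pos (by norm_num : (0 : ℝ) < 1 / 2)]
  refine mul_le_mul_of_nonneg_left ?_ (by norm_num)
  rw [pow_two, Finset.sum_mul_sum, Finset.mul_sum]
  refine (Finset.abs_sum_le_sum_abs _ _).trans (Finset.sum_le_sum fun i _ => ?_)
  rw [Finset.mul_sum]
  exact (Finset.abs_sum_le_sum_abs _ _).trans (Finset.sum_le_sum fun j _ => hbd i j)

lemma abs_potential_sum_sub_le (hGr : IsGreenOn D h G K M r) {ι : Type*} [Fintype ι]
    [DecidableEq ι] {F : ι → E2 → ℝ} {a : ι → ℝ} (hM : 0 ≤ M) (hF : ∀ i, BddOn K (F i))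
    (hmass : ∀ i, ∫ x in D, |F i x| ≤ a i) {x : E2} (hx : x ∈ K) {i : ι}
    (hsep : ∀ j, j ≠ i → ∀ y, F j y ≠ 0 → r ≤ dist x y) :
    |potential D G (∑ j, F j) x - ∫ y, logKer x y * F i y| ≤ M * ∑ j, a j := by
  have hK : ∀ j y, F j y ≠ 0 → y ∈ K := fun j y hy => by
    by_contra h
    exact hy ((hF j).supp y h)
  have hint := fun j => (hF j).integrable hGr.bounded
  have hsum : potential D G (∑ j, F j) x - ∫ y, logKer x y * F i y =
      ∑ j, (potential D G (F j) x - (if j = i then ∫ y, logKer x y * F j y else 0)) := by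
    rw [hGr.potential_sum _ (fun j _ => hF j) hx, Finset.sum_sub_distrib]
    simp
  rw [hsum, Finset.mul_sum]
  refine (Finset.abs_sum_le_sum_abs _ _).trans (Finset.sum_le_sum fun j _ => ?_)
  refine le_trans ?_ (mul_le_mul_of_nonneg_left (hmass j) hM)
  by_cases h : j = i
  · subst h
    rw [if_pos rfl, hGr.potential_eq (hF j) hx, sub_sub_cancel_left, abs_neg]
    exact abs_potential_le (hint j) fun y hy => hGr.abs_reg_le x hx y (hK j y hy)
  · rw [if_neg h, sub_zero]
    exact abs_potential_le (hint j) fun y hy => hGr.abs_le x hx y (hK j y hy) (hsep j h y hy)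

end IsGreenOn

lemma interaction_smul_smul (D : Set E2) (k : E2 → E2 → ℝ) (f : E2 → ℝ) (a : ℝ) :
    interaction D k (a • f) (a • f) = a ^ 2 * interaction D k f f := by
  rw [interaction, interaction, ← integral_const_mul]
  refine integral_congr_ae (Eventually.of_forall fun q => ?_)
  simp only [Pi.smul_apply, smul_eq_mul]
  ring

lemma BddOn.interaction_logKer {K D : Set E2} {f : E2 → ℝ} (hf : BddOn K f)
    (hK : Bornology.IsBounded K) (hKD : K ⊆ D) :
    Integrable (fun x => (∫ y, logKer x y * f y) * f x) ∧
    interaction D logKer f f = ∫ x, (∫ y, logKer x y * f y) * f x := by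
  have h1 := hf.integrable_logKer_mul_mul hf hK
  have h2 : (fun x => ∫ y, logKer x y * f x * f y) =
      fun x => (∫ y, logKer x y * f y) * f x := by
    ext x
    rw [← integral_mul_const]
    congr 1 with y
    ring
  refine ⟨h2 ▸ h1.integral_prod_left, ?_⟩
  rw [← h2, interaction, Measure.prod_restrict, setIntegral_eq_integral_of_forall_compl_eq_zero,
    integral_prod _ h1]
  intro q hq
  by_cases hx : q.1 ∈ K
  · have : q.2 ∉ K := fun h => hq ⟨hKD hx, hKD h⟩
    simp [hf.supp _ this]
  · simp [hf.supp _ hx]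

lemma exists_interaction_le {D : Set E2} {c : E2} {δ m : ℝ} {u : E2 → ℝ}
    (hD : ball c δ ⊆ D) (hu : BddOn (ball c δ) u) (hu0 : ∀ᵐ x, 0 ≤ u x) (hm : 0 < m)
    (hmass : ∫ x, u x = m) :
    ∃ x ∈ ball c δ, interaction D logKer u u - 1 ≤ m * ∫ y, logKer x y * u y := by
  obtain ⟨hint, heq⟩ := hu.interaction_logKer isBounded_ball hD
  by_contra! hcon
  have hle : ∫ x, (∫ y, logKer x y * u y) * u x ≤
      ∫ x, (interaction D logKer u u - 1) / m * u x := by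
    refine integral_mono_ae hint ((hu.integrable isBounded_ball).const_mul _) ?_
    filter_upwards [hu0] with x h0
    by_cases hx : x ∈ ball c δ
    · refine mul_le_mul_of_nonneg_right ?_ h0
      rw [le_div_iff₀ hm, mul_comm]
      exact (hcon x hx).le
    · simp [hu.supp x hx]
  rw [← heq, integral_const_mul, hmass, div_mul_cancel₀ _ hm.ne'] at hle
  linarith

lemma volume_real_ball (c : E2) {r : ℝ} (hr : 0 ≤ r) : volume.real (ball c r) = π * r ^ 2 := by
  rw [Measure.real, EuclideanSpace.volume_ball_fin_two, ENNReal.toReal_mul, ENNReal.toReal_pow,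
    ENNReal.toReal_ofReal hr, ENNReal.toReal_ofReal pi_pos.le, mul_comm]

/-- The level of a maximizing patch controls its logarithmic self-interaction. -/
lemma interaction_le_essInf_mul {D : Set E2} {c : E2} {δ m r lam C : ℝ} {u Φ : E2 → ℝ}
    (hD : ball c δ ⊆ D) (hr : 0 < r) (hrδ : 2 * r ≤ δ) (hm : 0 < m)
    (hrm : lam * (π * r ^ 2) = m)
    (hu : BddOn (ball c δ) u) (hu0 : ∀ᵐ x, 0 ≤ u x) (hu1 : ∀ᵐ x, u x ≤ lam)
    (hmass : ∫ x, u x = m)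
    (hΦ : ∀ g, BddOn (ball c δ) g → Integrable (fun x => Φ x * g x))
    (hvar : ∀ η, BddOn (ball c δ) η → ∫ x, η x = 0 →
      (∃ t0 > 0, ∀ t, 0 < t → t ≤ t0 → ∀ x, 0 ≤ u x → u x ≤ lam →
        0 ≤ u x + t * η x ∧ u x + t * η x ≤ lam) → ∫ x, Φ x * η x ≤ 0)
    (hUΦ : ∀ x ∈ ball c δ, (∫ y, logKer x y * u y) - C ≤ Φ x) :
    interaction D logKer u u -
      (1 + (2 / π) * ((∫ v in ball (0 : E2) 1, ‖v‖⁻¹) / π + 1) * m ^ 2 + C * m) ≤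
      essInf Φ (volume.restrict {x ∈ ball c δ | 0 < u x}) * m := by
  have hδ : 0 < δ := by linarith
  obtain ⟨x, hx, hxI⟩ := exists_interaction_le hD hu hu0 hm hmass
  set c₁ := ∫ v in ball (0 : E2) 1, ‖v‖⁻¹
  set U := fun x => ∫ y, logKer x y * u y with hU
  have hlam : 0 < lam := by
    by_contra! h
    have : lam * (π * r ^ 2) ≤ 0 := mul_nonpos_of_nonpos_of_nonneg h (by positivity)
    linarith
  have hθ : 2 * r / δ ≤ 1 := (div_le_one hδ).2 hrδ
  have hθ0 : 0 ≤ 2 * r / δ := by positivity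
  set w : E2 := x - (2 * r / δ) • (x - c) with hw
  have hxc : ‖x - c‖ < δ := by rwa [← dist_eq_norm]
  have hwx : dist w x ≤ 2 * r := by
    rw [dist_eq_norm, hw, sub_sub_cancel_left, norm_neg, norm_smul, Real.norm_of_nonneg hθ0]
    calc 2 * r / δ * ‖x - c‖ ≤ 2 * r / δ * δ := by gcongr
      _ = 2 * r := by field_simp
  have hwc : dist w c ≤ δ - 2 * r := by
    have : w - c = (1 - 2 * r / δ) • (x - c) := by
      rw [hw, sub_smul, one_smul]
      abel
    rw [dist_eq_norm, this, norm_smul, Real.norm_of_nonneg (by linarith)]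
    calc (1 - 2 * r / δ) * ‖x - c‖ ≤ (1 - 2 * r / δ) * δ := by
          gcongr
      _ = δ - 2 * r := by field_simp
  have hBsub : ball w (2 * r) ⊆ ball c δ := ball_subset_ball' (by linarith)
  have hui := hu.integrable isBounded_ball
  have hα : 0 < ∫ y in ball w (2 * r), (lam - u y) := by
    have hci : IntegrableOn (fun _ : E2 => lam) (ball w (2 * r)) :=
      integrableOn_const measure_ball_lt_top.ne
    rw [integral_sub hci hui.integrableOn,
      setIntegral_const, volume_real_ball w (by positivity), smul_eq_mul]
    have : ∫ y in ball w (2 * r), u y ≤ m := hmass ▸ setIntegral_le_integral hui hu0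
    nlinarith
  have hUx : ∀ y ∈ ball w (2 * r),
      U x - (2 / π) * (c₁ / π + 1) * m - C ≤ Φ y := by
    intro y hy
    have hxy : dist x y ≤ 4 * r := by
      have := dist_triangle x w y
      rw [dist_comm x w, dist_comm w y] at this
      rw [mem_ball] at hy
      linarith
    have h1 := integral_logKer_mul_ge isBounded_ball hr hu hu0 hu1 hxy
    have h2 : (1 / (2 * π)) * (4 * r) * (lam * (r * c₁) + r⁻¹ * ∫ y, u y) =
        (2 / π) * (c₁ / π + 1) * m := by
      rw [hmass, ← hrm]
      field_simp
      ring
    rw [h2] at h1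
    have h3 := hUΦ y (hBsub hy)
    simp only [hU]
    linarith
  have hae := ae_le_of_first_variation hu hu1 hΦ hvar measurableSet_ball hBsub hα hUx
  have hS : volume {x ∈ ball c δ | 0 < u x} ≠ 0 := by
    intro h0
    have : ∀ᵐ x, u x = 0 := by
      filter_upwards [measure_eq_zero_iff_ae_notMem.1 h0, hu0] with y hy hy0
      by_contra hne
      refine hy ⟨?_, lt_of_le_of_ne hy0 (Ne.symm hne)⟩
      by_contra hyb
      exact hne (hu.supp y hyb)
    rw [integral_congr_ae this, integral_zero] at hmass
    exact hm.ne hmass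
  have hSm : MeasurableSet {x ∈ ball c δ | 0 < u x} :=
    measurableSet_ball.inter (measurableSet_lt measurable_const hu.meas)
  have hess : U x - (2 / π) * (c₁ / π + 1) * m - C ≤
      essInf Φ (volume.restrict {x ∈ ball c δ | 0 < u x}) := by
    refine le_essInf_restrict hS ?_
    rw [ae_restrict_iff' hSm]
    filter_upwards [hae] with y hy hyS using hy hyS.2
  have := mul_le_mul_of_nonneg_right hess hm.le
  simp only [hU] at this
  nlinarith

lemma interaction_ball_ge {D : Set E2} {c : E2} {r a : ℝ} (hr : 0 < r)
    (hD : ball c r ⊆ D) :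
    (1 / (2 * π)) * Real.log (1 / (2 * r)) * (a * (π * r ^ 2)) ^ 2 ≤
      interaction D logKer (a • (ball c r).indicator 1) (a • (ball c r).indicator 1) := by
  set f : E2 → ℝ := (ball c r).indicator 1 with hf
  have hb : BddOn (ball c r) f :=
    ⟨measurable_one.indicator measurableSet_ball, ⟨1, Eventually.of_forall fun x => by
      by_cases hx : x ∈ ball c r <;> simp [hf, hx]⟩, fun x hx => by simp [hf, hx]⟩
  have hf0 : ∀ x, 0 ≤ f x := fun x => Set.indicator_nonneg (fun _ _ => zero_le_one) x
  have hfi := hb.integrable isBounded_ball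
  have hmass : ∫ x, f x = π * r ^ 2 := by
    rw [hf, integral_indicator measurableSet_ball]
    simp [volume_real_ball c hr.le]
  obtain ⟨hint, heq⟩ := hb.interaction_logKer isBounded_ball hD
  rw [interaction_smul_smul, heq, mul_pow]
  set b := (1 / (2 * π)) * Real.log (1 / (2 * r)) with hbdef
  have hU : ∀ x ∈ ball c r, b * (π * r ^ 2) ≤ ∫ y, logKer x y * f y := by
    intro x hx
    rw [← hmass, ← integral_const_mul]
    refine integral_mono_ae (hfi.const_mul b) (hb.integrable_logKer_mul isBounded_ball x) ?_
    have hne : ∀ᵐ y : E2, y ≠ x := by simp [ae_iff]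
    filter_upwards [hne] with y hyx
    by_cases hy : y ∈ ball c r
    · refine mul_le_mul_of_nonneg_right ?_ (hf0 y)
      have h0 : 0 < dist x y := dist_pos.2 hyx.symm
      have h1 : dist x y ≤ 2 * r := by
        have := dist_triangle_right x y c
        rw [mem_ball] at hx hy
        linarith
      simp only [logKer, hbdef]
      gcongr
    · simp [hb.supp y hy]
  have hle : ∫ x, b * (π * r ^ 2) * f x ≤ ∫ x, (∫ y, logKer x y * f y) * f x := by
    refine integral_mono (hfi.const_mul _) hint fun x => ?_
    by_cases hx : x ∈ ball c r
    · exact mul_le_mul_of_nonneg_right (hU x hx) (hf0 x)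
    · simp [hb.supp x hx]
  rw [integral_const_mul, hmass] at hle
  nlinarith [mul_le_mul_of_nonneg_left hle (sq_nonneg a)]

lemma le_dist_of_disjoint_closedBall {x y a b : E2} {δ r : ℝ} (hδ : δ < r / 2)
    (hdisj : Disjoint (closedBall a r) (closedBall b r)) (hx : x ∈ closedBall a δ)
    (hy : y ∈ closedBall b δ) : r ≤ dist x y := by
  by_contra! hlt
  rw [mem_closedBall] at hx hy
  have h1 : dist (midpoint ℝ x y) x ≤ r / 2 := by
    rw [dist_midpoint_left]
    norm_num
    linarith
  have h2 : dist (midpoint ℝ x y) y ≤ r / 2 := by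
    rw [dist_midpoint_right]
    norm_num
    linarith
  exact Set.disjoint_left.1 hdisj
    (mem_closedBall.2 ((dist_triangle (midpoint ℝ x y) x a).trans (by linarith)))
    (mem_closedBall.2 ((dist_triangle (midpoint ℝ x y) y b).trans (by linarith)))

lemma exists_isGreenOn {D K : Set E2} {h G : E2 → E2 → ℝ} {r : ℝ} (hD : IsOpen D)
    (hK : IsCompact K) (hKD : K ⊆ D) (hr : 0 < r)
    (hcont : ContinuousOn (fun q : E2 × E2 => h q.1 q.2) (D ×ˢ D))
    (hsymm : ∀ x ∈ D, ∀ y ∈ D, h x y = h y x) (hG : ∀ x y, G x y = logKer x y - h x y) :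
    ∃ M, 0 ≤ M ∧ IsGreenOn D h G K M r := by
  have hcK := hcont.mono (Set.prod_mono hKD hKD)
  obtain ⟨M₁, hM₁⟩ := (hK.prod hK).exists_bound_of_continuousOn hcK
  set S : Set (E2 × E2) := (K ×ˢ K) ∩ {q | r ≤ dist q.1 q.2}
  have hS : IsCompact S := (hK.prod hK).inter_right
    (isClosed_le continuous_const continuous_dist)
  have hcG : ContinuousOn (fun q : E2 × E2 => G q.1 q.2) S := by
    simp only [hG, logKer]
    refine ContinuousOn.sub (continuousOn_const.mul ?_) (hcK.mono Set.inter_subset_left)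
    have hpos : ∀ q ∈ S, dist q.1 q.2 ≠ 0 := fun q hq => (hr.trans_le hq.2).ne'
    exact (continuousOn_const.div continuous_dist.continuousOn hpos).log
      fun q hq => one_div_ne_zero (hpos q hq)
  obtain ⟨M₂, hM₂⟩ := hS.exists_bound_of_continuousOn hcG
  refine ⟨max 0 (max M₁ M₂), le_max_left _ _, hD, hKD, hK.isBounded, hcont, hsymm, hG, ?_, ?_⟩
  · exact fun x hx y hy => (hM₁ (x, y) ⟨hx, hy⟩).trans
      ((le_max_left _ _).trans (le_max_right _ _))
  · exact fun x hx y hy hxy => (hM₂ (x, y) ⟨⟨hx, hy⟩, hxy⟩).trans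
      ((le_max_right _ _).trans (le_max_right _ _))

theorem levels_weighted_lower_bound
    (p l : ℕ) (hp : 0 < p) (hl : 0 < l)
    (D : Set E2) (hDopen : IsOpen D) (hDbdd : Bornology.IsBounded D)
    (hDsc : SimplyConnectedSpace D)
    (h : E2 → E2 → ℝ)
    (hcont : ContinuousOn (fun q : E2 × E2 => h q.1 q.2) (D ×ˢ D))
    (hsymm : ∀ x ∈ D, ∀ y ∈ D, h x y = h y x)
    (hharm : ∀ y ∈ D, ContDiffOn ℝ 2 (fun x => h x y) D ∧
      ∀ x ∈ D, ∑ i : Fin 2,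
        iteratedFDerivWithin ℝ 2 (fun x' => h x' y) D x
          ![EuclideanSpace.single i 1, EuclideanSpace.single i 1] = 0)
    (G : E2 → E2 → ℝ)
    (hG : ∀ x y, G x y = (1 / (2 * π)) * Real.log (1 / dist x y) - h x y)
    (hGbdry : ∀ y ∈ D, ∀ z ∈ frontier D,
      Tendsto (fun x => G x y) (𝓝[D] z) (𝓝 0))
    (κ : Fin (p + l) → ℝ) (hκ : ∀ i, κ i ≠ 0)
    (xb : Fin (p + l) → E2) (hxbD : ∀ i, xb i ∈ D) (hxbinj : Function.Injective xb)
    (δ0 : ℝ) (hδ0 : 0 < δ0)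
    (hball : ∀ i, closedBall (xb i) δ0 ⊆ D)
    (hdisj : ∀ i j, i ≠ j → Disjoint (closedBall (xb i) δ0) (closedBall (xb j) δ0))
    (KR : (Fin (p + l) → E2) → ℝ)
    (hKR : ∀ y, KR y =
      -(∑ i, ∑ j ∈ Finset.univ.filter (fun j => j ≠ i), κ i * κ j * G (y i) (y j))
      + ∑ i, (κ i) ^ 2 * h (y i) (y i))
    (hmin : ∀ y : Fin (p + l) → E2, (∀ i, y i ∈ closedBall (xb i) δ0) →
      Function.Injective y → y ≠ xb → KR xb < KR y)
    (ψ : (E2 → ℝ) → E2 → ℝ)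
    (hψ : ∀ ω x, ψ ω x = ∫ y in D, G x y * ω y)
    (En : (E2 → ℝ) → ℝ)
    (hEn : ∀ ω, En ω = (1 / 2) * ∫ x in D, ∫ y in D, G x y * ω x * ω y)
    (EE : (E2 → ℝ) → (Fin l → E2) → ℝ)
    (hEE : ∀ ω z, EE ω z = En ω
      + ∑ j, κ (Fin.natAdd p j) * ψ ω (z j)
      + (1 / 2) * ∑ i, ∑ j ∈ Finset.univ.filter (fun j => j ≠ i),
          κ (Fin.natAdd p i) * κ (Fin.natAdd p j) * G (z i) (z j)
      - ∑ j, (κ (Fin.natAdd p j)) ^ 2 * ((1 / 2) * h (z j) (z j)))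
    (Adm : ℝ → ℝ → (Fin p → E2 → ℝ) → Prop)
    (hAdm : ∀ δ lam ωs, Adm δ lam ωs ↔ ∀ i : Fin p,
      Measurable (ωs i)
      ∧ (∀ x, x ∉ ball (xb (Fin.castAdd l i)) δ → ωs i x = 0)
      ∧ (∫ x in D, ωs i x) = κ (Fin.castAdd l i)
      ∧ (∀ᵐ x : E2 ∂volume, 0 ≤ Real.sign (κ (Fin.castAdd l i)) * ωs i x
          ∧ Real.sign (κ (Fin.castAdd l i)) * ωs i x ≤ lam))
    (δ : ℝ) (hδ : 0 < δ) (hδ2 : δ < δ0 / 2)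
    (hbdry : ∀ lam, 0 < lam → ∀ (ωs : Fin p → E2 → ℝ) (z : Fin l → E2),
      Adm δ lam ωs ∧ (∀ j, z j ∈ closedBall (xb (Fin.natAdd p j)) δ) ∧
      (∀ (ωs' : Fin p → E2 → ℝ) (z' : Fin l → E2), Adm δ lam ωs' →
        (∀ j, z' j ∈ closedBall (xb (Fin.natAdd p j)) δ) →
        EE (∑ i, ωs' i) z' ≤ EE (∑ i, ωs i) z) →
      ∀ i : Fin p, ∀ x ∈ sphere (xb (Fin.castAdd l i)) δ0,
        Real.sign (κ (Fin.castAdd l i)) * (ψ (∑ i', ωs i') x + ∑ j, κ (Fin.natAdd p j) * G (z j) x) ≤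
        essInf (fun x => Real.sign (κ (Fin.castAdd l i)) * (ψ (∑ i', ωs i') x + ∑ j, κ (Fin.natAdd p j) * G (z j) x))
        (volume.restrict {x ∈ ball (xb (Fin.castAdd l i)) δ | 0 < Real.sign (κ (Fin.castAdd l i)) * ωs i x}))
    :
    ∃ C > 0, ∃ lam1 > 0, ∀ lam, lam1 ≤ lam →
      ∀ (ωs : Fin p → E2 → ℝ) (z : Fin l → E2),
      (Adm δ lam ωs ∧ (∀ j, z j ∈ closedBall (xb (Fin.natAdd p j)) δ) ∧
      (∀ (ωs' : Fin p → E2 → ℝ) (z' : Fin l → E2), Adm δ lam ωs' →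
        (∀ j, z' j ∈ closedBall (xb (Fin.natAdd p j)) δ) →
        EE (∑ i, ωs' i) z' ≤ EE (∑ i, ωs i) z)) →
      -(1 / (2 * π)) * (∑ i : Fin p, (κ (Fin.castAdd l i)) ^ 2 *
          Real.log (Real.sqrt (|κ (Fin.castAdd l i)| / (π * lam)))) - C ≤
        ∑ i : Fin p, (essInf (fun x => Real.sign (κ (Fin.castAdd l i)) * (ψ (∑ i', ωs i') x + ∑ j, κ (Fin.natAdd p j) * G (z j) x))
        (volume.restrict {x ∈ ball (xb (Fin.castAdd l i)) δ | 0 < Real.sign (κ (Fin.castAdd l i)) * ωs i x})) * |κ (Fin.castAdd l i)| := by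
  obtain rfl : ψ = potential D G := funext fun ω => funext fun x => hψ ω x
  obtain rfl : En = energy D G := funext fun ω => hEn ω
  set K : Set E2 := ⋃ i, closedBall (xb i) δ0 with hKdef
  have hKc : IsCompact K := isCompact_iUnion fun i => isCompact_closedBall _ _
  have hKD : K ⊆ D := Set.iUnion_subset hball
  obtain ⟨M, hM, hGr⟩ := exists_isGreenOn hDopen hKc hKD hδ0 hcont hsymm hG
  have hδ' : δ ≤ δ0 := by linarith
  have hcK : ∀ i, closedBall (xb i) δ ⊆ K := fun i =>
    (closedBall_subset_closedBall hδ').trans (Set.subset_iUnion (fun i => closedBall (xb i) δ0) i)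
  have hbK : ∀ i, ball (xb i) δ ⊆ K := fun i => ball_subset_closedBall.trans (hcK i)
  have hsep : ∀ i j, i ≠ j → ∀ x ∈ closedBall (xb i) δ, ∀ y ∈ closedBall (xb j) δ,
      δ0 ≤ dist x y := fun i j hij x hx y hy =>
    le_dist_of_disjoint_closedBall hδ2 (hdisj i j hij) hx hy
  have hne : ∀ i j, Fin.castAdd l i ≠ Fin.natAdd p j := fun i j h => by
    have := congrArg Fin.val h
    simp only [Fin.val_castAdd, Fin.val_natAdd] at this
    omega
  have hsgn : ∀ i, Real.sign (κ i) * κ i = |κ i| := fun i => by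
    rcases lt_or_gt_of_ne (hκ i) with hi | hi
    · rw [Real.sign_of_neg hi, abs_of_neg hi, neg_one_mul]
    · rw [Real.sign_of_pos hi, abs_of_pos hi, one_mul]
  have hsgn1 : ∀ i, |Real.sign (κ i)| = 1 := fun i => by
    rcases lt_or_gt_of_ne (hκ i) with h | h
    · simp [Real.sign_of_neg h]
    · simp [Real.sign_of_pos h]
  have hsgn2 : ∀ i, Real.sign (κ i) * Real.sign (κ i) = 1 := fun i => by
    rw [← abs_mul_abs_self, hsgn1, one_mul]
  set a : Fin p → ℝ := fun i => |κ (Fin.castAdd l i)| with ha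
  set b : Fin l → ℝ := fun j => |κ (Fin.natAdd p j)| with hb
  have ha0 : ∀ i, 0 < a i := fun i => abs_pos.2 (hκ _)
  set A := ∑ i, a i with hA
  -- elementary consequences of admissibility
  have hadm : ∀ lam ωs, Adm δ lam ωs → ∀ i : Fin p,
      BddOn (ball (xb (Fin.castAdd l i)) δ) (ωs i) ∧ ∫ x in D, |ωs i x| = a i := by
    intro lam ωs hω i
    obtain ⟨h1, h2, h3, h4⟩ := (hAdm δ lam ωs).1 hω i
    have habs : ∀ᵐ x, |ωs i x| = Real.sign (κ (Fin.castAdd l i)) * ωs i x := by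
      filter_upwards [h4] with x hx
      rw [← abs_of_nonneg hx.1, abs_mul, hsgn1, one_mul]
    refine ⟨⟨h1, ⟨lam, ?_⟩, h2⟩, ?_⟩
    · filter_upwards [h4, habs] with x hx hx'
      exact hx' ▸ hx.2
    · rw [integral_congr_ae (ae_restrict_of_ae habs), integral_const_mul, h3, hsgn]
  -- the energy is the sum of the self-interactions up to a bounded error
  obtain ⟨C₀, hC₀⟩ : ∃ C₀, ∀ lam ωs z, Adm δ lam ωs →
      (∀ j, z j ∈ closedBall (xb (Fin.natAdd p j)) δ) →
      |EE (∑ i, ωs i) z - (1 / 2) * ∑ i, interaction D logKer (ωs i) (ωs i)| ≤ C₀ := by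
    refine ⟨(1 / 2) * (M * A ^ 2) + ∑ j, b j * (M * A) +
      (1 / 2) * ∑ i, ∑ j ∈ Finset.univ.filter (fun j => j ≠ i), b i * b j * M +
      ∑ j, b j ^ 2 * ((1 / 2) * M), fun lam ωs z hω hz => ?_⟩
    have hB := fun i => (hadm lam ωs hω i).1.mono (hbK _)
    have hz' : ∀ j, z j ∈ K := fun j => hcK _ (hz j)
    have hmem : ∀ i x, ωs i x ≠ 0 → x ∈ closedBall (xb (Fin.castAdd l i)) δ := fun i x hx => by
      by_contra h
      exact hx ((hadm lam ωs hω i).1.supp x fun h' => h (ball_subset_closedBall h'))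
    have e1 := hGr.abs_energy_sum_sub_le hM hB (fun i => (hadm lam ωs hω i).2.le)
      fun i j hij x y hx hy => hsep _ _ (fun h => hij (Fin.castAdd_injective p l h))
        x (hmem i x hx) y (hmem j y hy)
    have e2 : |∑ j, κ (Fin.natAdd p j) * potential D G (∑ i, ωs i) (z j)| ≤
        ∑ j, b j * (M * A) := by
      refine (Finset.abs_sum_le_sum_abs _ _).trans (Finset.sum_le_sum fun j _ => ?_)
      rw [abs_mul]
      refine mul_le_mul_of_nonneg_left ?_ (abs_nonneg _)
      rw [hGr.potential_sum _ (fun i _ => hB i) (hz' j), hA, Finset.mul_sum]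
      refine (Finset.abs_sum_le_sum_abs _ _).trans (Finset.sum_le_sum fun i _ => ?_)
      rw [← (hadm lam ωs hω i).2]
      refine abs_potential_le ((hB i).integrable hGr.bounded) fun y hy => ?_
      exact hGr.abs_le _ (hz' j) y (hcK _ (hmem i y hy))
        (hsep _ _ (hne i j).symm _ (hz j) y (hmem i y hy))
    have e3 : |(1 / 2) * ∑ i, ∑ j ∈ Finset.univ.filter (fun j => j ≠ i),
        κ (Fin.natAdd p i) * κ (Fin.natAdd p j) * G (z i) (z j)| ≤
        (1 / 2) * ∑ i, ∑ j ∈ Finset.univ.filter (fun j => j ≠ i), b i * b j * M := by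
      rw [abs_mul, abs_of_pos (by norm_num : (0 : ℝ) < 1 / 2)]
      refine mul_le_mul_of_nonneg_left ?_ (by norm_num)
      refine (Finset.abs_sum_le_sum_abs _ _).trans (Finset.sum_le_sum fun i _ => ?_)
      refine (Finset.abs_sum_le_sum_abs _ _).trans (Finset.sum_le_sum fun j hj => ?_)
      rw [abs_mul, abs_mul]
      refine mul_le_mul_of_nonneg_left ?_ (by positivity)
      refine hGr.abs_le _ (hz' i) _ (hz' j) (hsep _ _ (fun h => ?_) _ (hz i) _ (hz j))
      exact (Finset.mem_filter.1 hj).2 (Fin.natAdd_injective l p h).symm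
    have e4 : |∑ j, (κ (Fin.natAdd p j)) ^ 2 * ((1 / 2) * h (z j) (z j))| ≤
        ∑ j, b j ^ 2 * ((1 / 2) * M) := by
      refine (Finset.abs_sum_le_sum_abs _ _).trans (Finset.sum_le_sum fun j _ => ?_)
      rw [abs_mul, abs_mul, abs_pow, abs_of_pos (by norm_num : (0 : ℝ) < 1 / 2)]
      have := hGr.abs_reg_le _ (hz' j) _ (hz' j)
      gcongr
    rw [hEE]
    rw [abs_le] at *
    constructor <;> linarith [e1.1, e1.2, e2.1, e2.2, e3.1, e3.2, e4.1, e4.2]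
  -- first variation of the energy with respect to the density
  have hfirst : ∀ lam ωs z, Adm δ lam ωs →
      (∀ j, z j ∈ closedBall (xb (Fin.natAdd p j)) δ) → ∀ g t, BddOn K g →
      EE (∑ i, ωs i + t • g) z = EE (∑ i, ωs i) z + t * (∫ x in D,
        (potential D G (∑ i, ωs i) x + ∑ j, κ (Fin.natAdd p j) * G (z j) x) * g x) +
        t ^ 2 * energy D G g := by
    intro lam ωs z hω hz g t hg
    have hz' : ∀ j, z j ∈ K := fun j => hcK _ (hz j)
    have hF : BddOn K (∑ i, ωs i) :=
      BddOn.sum _ fun i _ => (hadm lam ωs hω i).1.mono (hbK _)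
    have hint : ∀ j ∈ Finset.univ, Integrable
        (fun x => κ (Fin.natAdd p j) * (G (z j) x * g x)) (volume.restrict D) :=
      fun j _ => (hGr.integrable hg (hz' j)).const_mul _
    have hsplit : ∫ x in D,
        (potential D G (∑ i, ωs i) x + ∑ j, κ (Fin.natAdd p j) * G (z j) x) * g x =
        (∫ x in D, potential D G (∑ i, ωs i) x * g x) +
          ∑ j, κ (Fin.natAdd p j) * potential D G g (z j) := by
      simp only [add_mul, Finset.sum_mul, mul_assoc]
      rw [integral_add (hGr.integrable_potential_mul hF hg) (integrable_finsetSum _ hint),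
        integral_finsetSum _ hint]
      simp only [integral_const_mul, potential]
    rw [hEE, hEE, hGr.energy_add_smul hF hg, hsplit]
    have hpot : ∑ j, κ (Fin.natAdd p j) * potential D G (∑ i, ωs i + t • g) (z j) =
        ∑ j, κ (Fin.natAdd p j) * potential D G (∑ i, ωs i) (z j) +
          t * ∑ j, κ (Fin.natAdd p j) * potential D G g (z j) := by
      rw [Finset.mul_sum, ← Finset.sum_add_distrib]
      refine Finset.sum_congr rfl fun j _ => ?_
      rw [hGr.potential_add_smul hF hg t (hz' j)]
      ring
    rw [hpot]
    ring
  set C₂ := M * A + M * ∑ j, b j with hC₂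
  set C₃ := (2 / π) * ((∫ v in ball (0 : E2) 1, ‖v‖⁻¹) / π + 1) with hC₃
  set R := ∑ i, (1 + C₃ * a i ^ 2 + C₂ * a i) with hR
  set T := ∑ i, (1 / (2 * π)) * Real.log 2 * a i ^ 2 with hT
  refine ⟨|R + T + 4 * C₀| + 1, by positivity, 1 + 4 * A / (π * δ ^ 2), ?_, ?_⟩
  · have : 0 ≤ A := Finset.sum_nonneg fun i _ => (ha0 i).le
    positivity
  rintro lam hlam ωs z ⟨hω, hz, hmax⟩
  have hA0 : 0 ≤ A := Finset.sum_nonneg fun i _ => (ha0 i).le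
  have hlam0 : 0 < lam := lt_of_lt_of_le (by positivity) hlam
  set r : Fin p → ℝ := fun i => Real.sqrt (a i / (π * lam)) with hr
  have hr0 : ∀ i, 0 < r i := fun i => Real.sqrt_pos.2 (div_pos (ha0 i) (by positivity))
  have hrsq : ∀ i, lam * (π * r i ^ 2) = a i := fun i => by
    have : 0 ≤ a i / (π * lam) := (div_pos (ha0 i) (by positivity)).le
    simp only [hr]
    rw [Real.sq_sqrt this]
    field_simp
  have hrδ : ∀ i, 2 * r i ≤ δ := fun i => by
    have h1 : a i ≤ A := Finset.single_le_sum (fun i _ => (ha0 i).le) (Finset.mem_univ i)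
    have h2 : 4 * A / (π * δ ^ 2) ≤ lam := by linarith
    rw [div_le_iff₀ (by positivity)] at h2
    have h3 : lam * π * (2 * r i) ^ 2 ≤ lam * π * δ ^ 2 := by
      nlinarith [hrsq i]
    exact le_of_sq_le_sq (le_of_mul_le_mul_left h3 (by positivity)) hδ.le
  -- comparison with circular patches centred at the points `xb i`
  have hlow : ∑ i, (1 / (2 * π)) * Real.log (1 / (2 * r i)) * a i ^ 2 - 4 * C₀ ≤
      ∑ i, interaction D logKer (ωs i) (ωs i) := by
    set τ : Fin p → E2 → ℝ := fun i => (Real.sign (κ (Fin.castAdd l i)) * lam) •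
      (ball (xb (Fin.castAdd l i)) (r i)).indicator 1 with hτ
    have hrD : ∀ i, ball (xb (Fin.castAdd l i)) (r i) ⊆ ball (xb (Fin.castAdd l i)) δ :=
      fun i => ball_subset_ball (by linarith [hrδ i, hr0 i])
    have hDi : ∀ i, ball (xb (Fin.castAdd l i)) (r i) ⊆ D := fun i =>
      (hrD i).trans ((hbK _).trans hKD)
    have hτadm : Adm δ lam τ := by
      refine (hAdm δ lam τ).2 fun i => ⟨?_, fun x hx => ?_, ?_, Eventually.of_forall fun x => ?_⟩
      · exact (measurable_one.indicator measurableSet_ball).const_smul _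
      · simp [hτ, Set.indicator_of_notMem fun h => hx (hrD i h)]
      · simp only [hτ, Pi.smul_apply, smul_eq_mul]
        rw [integral_const_mul, setIntegral_eq_integral_of_forall_compl_eq_zero,
          integral_indicator measurableSet_ball]
        · simp only [Pi.one_apply, setIntegral_const, smul_eq_mul, mul_one]
          rw [volume_real_ball _ (hr0 i).le, mul_assoc, hrsq, ha]
          simp only [← hsgn, ← mul_assoc, hsgn2, one_mul]
        · exact fun x hx => Set.indicator_of_notMem (fun h => hx (hDi i h)) _
      · simp only [hτ, Pi.smul_apply, smul_eq_mul, ← mul_assoc, hsgn2, one_mul]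
        by_cases hx : x ∈ ball (xb (Fin.castAdd l i)) (r i)
        · simp [hx, hlam0.le]
        · simp [hx, hlam0.le]
    have hzb : ∀ j, xb (Fin.natAdd p j) ∈ closedBall (xb (Fin.natAdd p j)) δ := fun j =>
      mem_closedBall_self hδ.le
    have h1 := hmax τ (fun j => xb (Fin.natAdd p j)) hτadm hzb
    have h2 := abs_le.1 (hC₀ lam τ _ hτadm hzb)
    have h3 := abs_le.1 (hC₀ lam ωs z hω hz)
    have h4 : ∑ i, (1 / (2 * π)) * Real.log (1 / (2 * r i)) * a i ^ 2 ≤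
        ∑ i, interaction D logKer (τ i) (τ i) := by
      refine Finset.sum_le_sum fun i _ => ?_
      have := interaction_ball_ge (a := Real.sign (κ (Fin.castAdd l i)) * lam) (hr0 i) (hDi i)
      rwa [mul_assoc (Real.sign _), hrsq, mul_pow, pow_two (Real.sign _), hsgn2, one_mul] at this
    linarith [h2.1, h3.2]
  -- lower bound for each level
  have hlevel : ∀ i : Fin p, interaction D logKer (ωs i) (ωs i) -
      (1 + C₃ * a i ^ 2 + C₂ * a i) ≤
      essInf (fun x => Real.sign (κ (Fin.castAdd l i)) *
        (potential D G (∑ i', ωs i') x + ∑ j, κ (Fin.natAdd p j) * G (z j) x))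
        (volume.restrict {x ∈ ball (xb (Fin.castAdd l i)) δ |
          0 < Real.sign (κ (Fin.castAdd l i)) * ωs i x}) * a i := by
    intro i
    set s := Real.sign (κ (Fin.castAdd l i)) with hs
    have hs2 : s * s = 1 := hsgn2 _
    have hs1 : |s| = 1 := hsgn1 _
    set c := xb (Fin.castAdd l i) with hc
    obtain ⟨h1, h2, h3, h4⟩ := (hAdm δ lam ωs).1 hω i
    have hz' : ∀ j, z j ∈ K := fun j => hcK _ (hz j)
    have hB := fun i => (hadm lam ωs hω i).1.mono (hbK _)
    have hF : BddOn K (∑ i, ωs i) := BddOn.sum _ fun i _ => hB i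
    have hDc : ball c δ ⊆ D := (hbK _).trans hKD
    have hDint : ∀ f : E2 → ℝ, (∀ x, x ∉ ball c δ → f x = 0) → ∫ x in D, f x = ∫ x, f x :=
      fun f hf => setIntegral_eq_integral_of_forall_compl_eq_zero
        fun x hx => hf x fun h => hx (hDc h)
    have hDintg : ∀ f : E2 → ℝ, (∀ x, x ∉ ball c δ → f x = 0) →
        Integrable f (volume.restrict D) → Integrable f :=
      fun f hf hfi => (integrableOn_iff_integrable_of_support_subset fun x hx => hDc <| by
        by_contra h
        exact hx (hf x h)).1 hfi
    have hu : BddOn (ball c δ) (s • ωs i) := (hadm lam ωs hω i).1.const_smul s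
    have hI : interaction D logKer (s • ωs i) (s • ωs i) =
        interaction D logKer (ωs i) (ωs i) := by
      rw [interaction_smul_smul, pow_two, hs2, one_mul]
    rw [← hI]
    refine interaction_le_essInf_mul (u := s • ωs i) hDc (hr0 i) (hrδ i) (ha0 i) (hrsq i) hu
      (h4.mono fun x hx => hx.1) (h4.mono fun x hx => hx.2) ?_ (fun g hg => ?_)
      (fun η hη hη0 hηt => ?_) (fun x hx => ?_)
    · simp only [Pi.smul_apply, smul_eq_mul]
      rw [integral_const_mul, ← hDint _ h2, h3, hs, hsgn]
    · refine hDintg _ (fun x hx => by simp [hg.supp x hx]) ?_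
      have hgK := hg.mono (hbK _)
      refine (((hGr.integrable_potential_mul hF hgK).add (integrable_finsetSum Finset.univ
        fun j _ => (hGr.integrable hgK (hz' j)).const_mul (κ (Fin.natAdd p j)))).const_mul
          s).congr (Eventually.of_forall fun x => ?_)
      simp only [Pi.add_apply, mul_assoc, add_mul, Finset.sum_mul]
    · obtain ⟨t0, ht0, hηt⟩ := hηt
      have hηs : BddOn K (s • η) := (hη.const_smul s).mono (hbK _)
      set P := ∫ x in D, (potential D G (∑ i, ωs i) x +
        ∑ j, κ (Fin.natAdd p j) * G (z j) x) * (s • η) x with hP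
      have hPeq : ∫ x, s * (potential D G (∑ i', ωs i') x +
          ∑ j, κ (Fin.natAdd p j) * G (z j) x) * η x = P := by
        rw [← hDint _ fun x hx => by simp [hη.supp x hx]]
        refine integral_congr_ae (Eventually.of_forall fun x => ?_)
        simp only [Pi.smul_apply, smul_eq_mul]
        ring
      rw [hPeq]
      have hquad : ∀ t, 0 < t → t ≤ t0 → P + t * energy D G (s • η) ≤ 0 := by
        intro t ht htt0
        set ωs' := Function.update ωs i (ωs i + t • s • η) with hωs'
        have hsum : ∑ i', ωs' i' = ∑ i', ωs i' + t • s • η := by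
          rw [hωs', Finset.sum_update_of_mem (Finset.mem_univ i), add_right_comm,
            Finset.sdiff_singleton_eq_erase, Finset.add_sum_erase _ _ (Finset.mem_univ i)]
        have hω' : Adm δ lam ωs' := by
          refine (hAdm δ lam ωs').2 fun i' => ?_
          by_cases hi : i' = i
          · subst hi
            rw [hωs', Function.update_self]
            refine ⟨h1.add ((hη.meas.const_smul s).const_smul t), fun x hx => ?_, ?_, ?_⟩
            · simp [h2 x hx, hη.supp x hx]
            · have i1 := (hB i').integrable hGr.bounded
              have i2 := hη.integrable isBounded_ball
              simp only [Pi.add_apply, Pi.smul_apply, smul_eq_mul]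
              rw [integral_add i1.restrict ((i2.const_mul s).const_mul t).restrict, h3,
                integral_const_mul, integral_const_mul, hDint _ hη.supp, hη0]
              ring
            · filter_upwards [h4] with x hx
              have := hηt t ht htt0 x hx.1 hx.2
              have he : s * (ωs i' + t • s • η) x = (s • ωs i') x + t * η x := by
                simp only [Pi.add_apply, Pi.smul_apply, smul_eq_mul]
                linear_combination t * η x * hs2
              rw [← hs, he]
              exact this
          · rw [hωs', Function.update_of_ne hi]
            exact (hAdm δ lam ωs).1 hω i'
        have hle := hmax ωs' z hω' hz
        rw [hsum, hfirst lam ωs z hω hz _ t hηs, ← hP] at hle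
        have : t * (P + t * energy D G (s • η)) ≤ 0 := by linarith
        exact nonpos_of_mul_nonpos_right this ht
      have hlim : Tendsto (fun t => P + t * energy D G (s • η)) (𝓝[>] 0) (𝓝 P) := by
        have : Continuous fun t : ℝ => P + t * energy D G (s • η) := by fun_prop
        simpa using (this.tendsto 0).mono_left nhdsWithin_le_nhds
      refine le_of_tendsto hlim ?_
      filter_upwards [Ioc_mem_nhdsGT ht0] with t ht using hquad t ht.1 ht.2
    · have hxc := ball_subset_closedBall hx
      have e1 := hGr.abs_potential_sum_sub_le hM hB (fun i => (hadm lam ωs hω i).2.le)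
        (hbK _ hx) (i := i) fun j hj y hy => hsep _ _
          (fun h => hj (Fin.castAdd_injective p l h).symm) x hxc y <| by
            by_contra hn
            exact hy ((hadm lam ωs hω j).1.supp y fun h' => hn (ball_subset_closedBall h'))
      have e2 : |∑ j, κ (Fin.natAdd p j) * G (z j) x| ≤ M * ∑ j, b j := by
        rw [Finset.mul_sum]
        refine (Finset.abs_sum_le_sum_abs _ _).trans (Finset.sum_le_sum fun j _ => ?_)
        rw [abs_mul, mul_comm]
        refine mul_le_mul_of_nonneg_right ?_ (abs_nonneg _)
        exact hGr.abs_le _ (hz' j) _ (hbK _ hx) (hsep _ _ (hne i j).symm _ (hz j) _ hxc)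
      have e3 : ∫ y, logKer x y * (s • ωs i) y = s * ∫ y, logKer x y * ωs i y := by
        rw [← integral_const_mul]
        refine integral_congr_ae (Eventually.of_forall fun y => ?_)
        simp only [Pi.smul_apply, smul_eq_mul]
        ring
      rw [e3]
      have e4 : |s * (potential D G (∑ i', ωs i') x - ∫ y, logKer x y * ωs i y)| ≤ M * A := by
        rwa [abs_mul, hs1, one_mul]
      have e5 : |s * ∑ j, κ (Fin.natAdd p j) * G (z j) x| ≤ M * ∑ j, b j := by
        rwa [abs_mul, hs1, one_mul]
      rw [mul_sub] at e4
      rw [mul_add]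
      linarith [(abs_le.1 e4).1, (abs_le.1 e5).1]
  have hfin := Finset.sum_le_sum fun i (_ : i ∈ Finset.univ) => hlevel i
  rw [Finset.sum_sub_distrib, ← hR] at hfin
  have hlog : ∑ i, (1 / (2 * π)) * Real.log (1 / (2 * r i)) * a i ^ 2 =
      -(1 / (2 * π)) * (∑ i : Fin p, (κ (Fin.castAdd l i)) ^ 2 * Real.log (r i)) - T := by
    rw [hT, Finset.mul_sum, ← Finset.sum_sub_distrib]
    refine Finset.sum_congr rfl fun i _ => ?_
    rw [one_div (2 * r i), Real.log_inv, Real.log_mul two_ne_zero (hr0 i).ne', ha, sq_abs]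
    ring
  rw [hlog] at hlow
  linarith [le_abs_self (R + T + 4 * C₀)]
end
end

section
/- Convergence of centers and point-vortex locations: assume δ ∈ (0, δ0/2) is such that for every λ > 0, every maximizer and every i ∈ {1,…,p}, sgn(κ_i)(ψ^λ + Σ_{j=p+1}^k κ_jG(x_j^λ,·)) ≤ c_i^λ everywhere on ∂B_{δ0}(x̄_i). For a maximizer define the centers z_i^λ := (1/κ_i)∫_D x·ω_i^λ(x)dx for i = 1,…,p. Then for every η > 0 there exists λ0 > 0 such that for every λ > λ0 and every maximizer (ω^λ, x_{p+1}^λ, …, x_k^λ): |z_i^λ − x̄_i| < η for all i = 1,…,p, and |x_j^λ − x̄_j| < η for all j = p+1,…,k. -/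
open MeasureTheory Metric Real Filter Topology

noncomputable section

open scoped ENNReal

/-- The logarithmic energy of a planar measure. -/
def logEnergy (μ : Measure E2) : ℝ := ∫ q : E2 × E2, log (1 / dist q.1 q.2) ∂(μ.prod μ)

theorem ae_prod_mem {α β : Type*} [MeasurableSpace α] [MeasurableSpace β] {μ : Measure α}
    {ν : Measure β} [SFinite μ] [SFinite ν] {s : Set α} {t : Set β}
    (hs : μ sᶜ = 0) (ht : ν tᶜ = 0) : ∀ᵐ q ∂(μ.prod ν), q.1 ∈ s ∧ q.2 ∈ t :=
  (Measure.quasiMeasurePreserving_fst.ae (p := (· ∈ s)) hs).and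
    (Measure.quasiMeasurePreserving_snd.ae (p := (· ∈ t)) ht)

theorem lintegral_posLog_div_dist_le {μ : Measure E2} {ε : ℝ} (hε : 0 < ε)
    (hμ : μ ≤ ENNReal.ofReal (ε ^ 2)⁻¹ • volume) (x : E2) :
    ∫⁻ y, ENNReal.ofReal (posLog (ε / dist x y)) ∂μ ≤ 2 := by
  rw [lintegral_eq_lintegral_meas_lt μ (ae_of_all _ fun _ => posLog_nonneg)
    (by unfold posLog; fun_prop)]
  have hsub : ∀ t ∈ Set.Ioi (0 : ℝ), μ {y | t < posLog (ε / dist x y)} ≤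
      ENNReal.ofReal (π * exp (-2 * t)) := by
    intro t ht
    have h1 : {y | t < posLog (ε / dist x y)} ⊆ ball x (ε * exp (-t)) := by
      intro y hy
      have hy' : t < max 0 (log (ε / dist x y)) := hy
      have hlog : t < log (ε / dist x y) := by
        rcases lt_max_iff.1 hy' with h | h
        · exact absurd h (not_lt.2 (le_of_lt ht))
        · exact h
      have hd : 0 < dist x y := by
        rcases (dist_nonneg (x := x) (y := y)).eq_or_lt with h | h
        · rw [← h] at hlog
          simp at hlog
          exact absurd hlog (not_lt.2 (le_of_lt ht))
        · exact h
      rw [lt_log_iff_exp_lt (by positivity), lt_div_iff₀ hd] at hlog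
      rw [mem_ball, dist_comm, exp_neg, ← div_eq_mul_inv, lt_div_iff₀ (exp_pos t)]
      linarith
    calc μ {y | t < posLog (ε / dist x y)} ≤ μ (ball x (ε * exp (-t))) := measure_mono h1
      _ ≤ (ENNReal.ofReal (ε ^ 2)⁻¹ • (volume : Measure E2)) (ball x (ε * exp (-t))) := hμ _
      _ = ENNReal.ofReal (π * exp (-2 * t)) := by
        rw [Measure.smul_apply, EuclideanSpace.volume_ball_fin_two, smul_eq_mul,
          ← ENNReal.ofReal_pow (by positivity), ← ENNReal.ofReal_mul (by positivity),
          ← ENNReal.ofReal_mul (by positivity)]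
        congr 1
        have : exp (-2 * t) = exp (-t) ^ 2 := by
          rw [← exp_nat_mul]; congr 1; push_cast; ring
        rw [this]
        field_simp
  have hGint : IntegrableOn (fun t : ℝ => π * exp (-2 * t)) (Set.Ioi 0) :=
    (integrableOn_exp_mul_Ioi (by norm_num) 0).const_mul _
  calc ∫⁻ t in Set.Ioi (0 : ℝ), μ {y | t < posLog (ε / dist x y)}
      ≤ ∫⁻ t in Set.Ioi (0 : ℝ), ENNReal.ofReal (π * exp (-2 * t)) :=
        setLIntegral_mono (by fun_prop) hsub
    _ = ENNReal.ofReal (∫ t in Set.Ioi (0 : ℝ), π * exp (-2 * t)) :=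
        (ofReal_integral_eq_lintegral_ofReal hGint
          (ae_of_all _ fun t => by positivity)).symm
    _ ≤ ENNReal.ofReal 2 := by
        apply ENNReal.ofReal_le_ofReal
        rw [integral_const_mul, integral_exp_mul_Ioi (by norm_num)]
        have := pi_le_four
        simp
        linarith
    _ = 2 := by simp

theorem measurable_posLog_div_dist (ε : ℝ) :
    Measurable fun q : E2 × E2 => posLog (ε / dist q.1 q.2) := by
  unfold posLog; fun_prop

theorem measurable_posLog_dist_div (ε : ℝ) :
    Measurable fun q : E2 × E2 => posLog (dist q.1 q.2 / ε) := by
  unfold posLog; fun_prop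

theorem integrable_posLog_div_dist {μ : Measure E2} [IsProbabilityMeasure μ] {ε : ℝ} (hε : 0 < ε)
    (hμ : μ ≤ ENNReal.ofReal (ε ^ 2)⁻¹ • volume) :
    Integrable (fun q : E2 × E2 => posLog (ε / dist q.1 q.2)) (μ.prod μ) ∧
    ∫ q : E2 × E2, posLog (ε / dist q.1 q.2) ∂(μ.prod μ) ≤ 2 := by
  have hm := measurable_posLog_div_dist ε
  have hle : ∫⁻ q : E2 × E2, ENNReal.ofReal (posLog (ε / dist q.1 q.2)) ∂(μ.prod μ) ≤ 2 := by
    rw [lintegral_prod _ hm.ennreal_ofReal.aemeasurable]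
    calc _ ≤ ∫⁻ _, 2 ∂μ := lintegral_mono fun x => lintegral_posLog_div_dist_le hε hμ x
      _ = 2 := by simp
  have hi : Integrable (fun q : E2 × E2 => posLog (ε / dist q.1 q.2)) (μ.prod μ) := by
    refine ⟨hm.aestronglyMeasurable, ?_⟩
    rw [hasFiniteIntegral_iff_ofReal (ae_of_all _ fun _ => posLog_nonneg)]
    exact lt_of_le_of_lt hle (by simp)
  refine ⟨hi, ?_⟩
  have := ofReal_integral_eq_lintegral_ofReal hi (ae_of_all _ fun _ => posLog_nonneg)
  rw [← this] at hle
  rw [← ENNReal.ofReal_le_ofReal_iff (by norm_num)]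
  simpa using hle

theorem integrable_posLog_dist_div {μ : Measure E2} [IsProbabilityMeasure μ] {c : E2} {R : ℝ}
    (hK : μ (closedBall c R)ᶜ = 0) {ε : ℝ} (hε : 0 < ε) :
    Integrable (fun q : E2 × E2 => posLog (dist q.1 q.2 / ε)) (μ.prod μ) := by
  refine Integrable.of_bound (measurable_posLog_dist_div ε).aestronglyMeasurable
    (posLog ((R + R) / ε)) ?_
  filter_upwards [ae_prod_mem hK hK] with q ⟨h2, h3⟩
  rw [Real.norm_of_nonneg posLog_nonneg]
  apply posLog_le_posLog (by positivity)
  have := dist_triangle_right q.1 q.2 c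
  rw [mem_closedBall] at h2 h3
  gcongr
  linarith

theorem log_one_div_dist_le {ε : ℝ} (hε : 0 < ε) (hε1 : ε ≤ 1) {d : ℝ} (hd : 0 ≤ d) :
    log (1 / d) ≤ log (1 / ε) + posLog (ε / d) - posLog (d / ε) := by
  have h0 : 0 ≤ log (1 / ε) := log_nonneg (by rw [le_div_iff₀ hε]; linarith)
  rcases hd.eq_or_lt with rfl | hd
  · simpa using h0
  · have h := posLog_sub_posLog_inv (x := ε / d)
    rw [inv_div, log_div hε.ne' hd.ne'] at h
    rw [one_div, log_inv, one_div, log_inv]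
    linarith

theorem integrable_log_one_div_dist {μ : Measure E2} [IsProbabilityMeasure μ] {c : E2} {R : ℝ}
    (hK : μ (closedBall c R)ᶜ = 0) {ε : ℝ} (hε : 0 < ε)
    (hμ : μ ≤ ENNReal.ofReal (ε ^ 2)⁻¹ • volume) :
    Integrable (fun q : E2 × E2 => log (1 / dist q.1 q.2)) (μ.prod μ) := by
  refine (((integrable_posLog_div_dist hε hμ).1.add
    (integrable_posLog_dist_div hK hε)).add (integrable_const |log ε|)).mono'
    (Measurable.aestronglyMeasurable (by fun_prop)) (ae_of_all _ fun q => ?_)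
  simp only [Pi.add_apply, norm_eq_abs]
  have hd := dist_nonneg (x := q.1) (y := q.2)
  have p1 : 0 ≤ posLog (ε / dist q.1 q.2) := posLog_nonneg
  have p2 : 0 ≤ posLog (dist q.1 q.2 / ε) := posLog_nonneg
  rcases hd.eq_or_lt with h | hd
  · rw [← h] at p1 p2 ⊢
    simp
  · have h := posLog_sub_posLog_inv (x := ε / dist q.1 q.2)
    rw [inv_div, log_div hε.ne' hd.ne'] at h
    rw [one_div, log_inv]
    rw [abs_le]
    have := neg_abs_le (log ε)
    have := le_abs_self (log ε)
    constructor <;> linarith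

/-- The logarithmic energy of a measure with bounded density, up to its spread at scale `ε`. -/
theorem logEnergy_add_integral_posLog_le {μ : Measure E2} [IsProbabilityMeasure μ] {c : E2} {R : ℝ}
    (hK : μ (closedBall c R)ᶜ = 0) {ε : ℝ} (hε : 0 < ε) (hε1 : ε ≤ 1)
    (hμ : μ ≤ ENNReal.ofReal (ε ^ 2)⁻¹ • volume) :
    logEnergy μ + ∫ q : E2 × E2, posLog (dist q.1 q.2 / ε) ∂(μ.prod μ) ≤ log (1 / ε) + 2 := by
  obtain ⟨hi, h2⟩ := integrable_posLog_div_dist hε hμ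
  have hd := integrable_posLog_dist_div hK hε
  have hl := integrable_log_one_div_dist hK hε hμ
  have hi' : Integrable (fun q : E2 × E2 => log (1 / ε) + posLog (ε / dist q.1 q.2)) (μ.prod μ) :=
    (integrable_const _).add hi
  have : logEnergy μ ≤ ∫ q : E2 × E2, (log (1 / ε) + posLog (ε / dist q.1 q.2)
      - posLog (dist q.1 q.2 / ε)) ∂(μ.prod μ) :=
    integral_mono hl (hi'.sub hd) fun q => log_one_div_dist_le hε hε1 dist_nonneg
  rw [integral_sub hi' hd, integral_add (integrable_const _) hi] at this
  simp only [integral_const, probReal_univ, smul_eq_mul, one_mul] at this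
  linarith

theorem logEnergy_le {μ : Measure E2} [IsProbabilityMeasure μ] {c : E2} {R : ℝ}
    (hK : μ (closedBall c R)ᶜ = 0) {ε : ℝ} (hε : 0 < ε) (hε1 : ε ≤ 1)
    (hμ : μ ≤ ENNReal.ofReal (ε ^ 2)⁻¹ • volume) : logEnergy μ ≤ log (1 / ε) + 2 := by
  have := logEnergy_add_integral_posLog_le hK hε hε1 hμ
  have : 0 ≤ ∫ q : E2 × E2, posLog (dist q.1 q.2 / ε) ∂(μ.prod μ) :=
    integral_nonneg fun _ => posLog_nonneg
  linarith

/-- A measure with almost maximal logarithmic energy charges little mass away from one point. -/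
theorem exists_mul_measureReal_le {μ : Measure E2} [IsProbabilityMeasure μ] {c : E2} {R : ℝ}
    (hK : μ (closedBall c R)ᶜ = 0) {ε C r : ℝ} (hε : 0 < ε) (hεr : ε < r) (hε1 : ε ≤ 1)
    (hμ : μ ≤ ENNReal.ofReal (ε ^ 2)⁻¹ • volume) (hC : log (1 / ε) - C ≤ logEnergy μ) :
    ∃ a ∈ closedBall c R, log (r / ε) * μ.real {x | r ≤ dist x a} ≤ C + 2 := by
  have h := logEnergy_add_integral_posLog_le hK hε hε1 hμ
  have hd := integrable_posLog_dist_div hK hε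
  rw [integral_prod _ hd] at h
  obtain ⟨a, ha, hle⟩ := exists_notMem_null_le_integral
    (N := (closedBall c R)ᶜ ∪ {x | ¬ Integrable (fun y => posLog (dist x y / ε)) μ})
    hd.integral_prod_left (measure_union_null hK hd.prod_right_ae)
  simp only [Set.mem_union, not_or, Set.mem_compl_iff, not_not, Set.mem_ofPred_eq] at ha
  refine ⟨a, ha.1, ?_⟩
  have hmk := mul_meas_ge_le_integral_of_nonneg (μ := μ) (ae_of_all _ fun _ => posLog_nonneg) ha.2
    (log (r / ε))
  have hset : μ.real {x | r ≤ dist x a} ≤ μ.real {y | log (r / ε) ≤ posLog (dist a y / ε)} := by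
    refine measureReal_mono (fun x hx => ?_)
    simp only [Set.mem_ofPred_eq] at hx ⊢
    refine le_trans ?_ (le_max_right _ _)
    rw [dist_comm a]
    have : 0 < r := hε.trans hεr
    exact log_le_log (by positivity) (by gcongr)
  have hpos : 0 < log (r / ε) := log_pos (by rwa [one_lt_div hε])
  have := mul_le_mul_of_nonneg_left hset hpos.le
  linarith

theorem lintegral_posLog_one_div_dist_le {μ : Measure E2} [IsProbabilityMeasure μ] {ε r M : ℝ}
    (hε : 0 < ε) (hε1 : ε ≤ 1) (hr : 0 < r)
    (hμ : μ ≤ ENNReal.ofReal (ε ^ 2)⁻¹ • volume) {a x : E2} (hx : r ≤ dist x a)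
    (hM : log (1 / ε) * μ.real {y | r / 2 ≤ dist y a} ≤ M) :
    ∫⁻ y, ENNReal.ofReal (posLog (1 / dist x y)) ∂μ ≤ ENNReal.ofReal (posLog (2 / r) + M + 2) := by
  have h0 : 0 ≤ log (1 / ε) := log_nonneg (by rw [le_div_iff₀ hε]; linarith)
  have hM0 : 0 ≤ M := le_trans (by positivity) hM
  set S := {y : E2 | r / 2 ≤ dist y a} with hS
  have hSm : MeasurableSet S := measurableSet_le measurable_const (by fun_prop)
  have hpt : ∀ y, ENNReal.ofReal (posLog (1 / dist x y)) ≤ ENNReal.ofReal (posLog (2 / r))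
      + S.indicator (fun _ => ENNReal.ofReal (log (1 / ε))) y
      + ENNReal.ofReal (posLog (ε / dist x y)) := by
    intro y
    by_cases hy : y ∈ S
    · rw [Set.indicator_of_mem hy, add_assoc, ← ENNReal.ofReal_add h0 posLog_nonneg]
      refine le_trans (ENNReal.ofReal_le_ofReal ?_) le_add_self
      refine max_le (add_nonneg h0 posLog_nonneg) ?_
      have := log_one_div_dist_le hε hε1 (dist_nonneg (x := x) (y := y))
      have : 0 ≤ posLog (dist x y / ε) := posLog_nonneg
      linarith
    · rw [Set.indicator_of_notMem hy, add_zero]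
      refine le_trans (ENNReal.ofReal_le_ofReal ?_) le_self_add
      simp only [hS, Set.mem_ofPred_eq, not_le] at hy
      have : r / 2 ≤ dist x y := by
        have := dist_triangle x y a
        linarith
      apply posLog_le_posLog (by positivity)
      rw [div_le_div_iff₀ (by linarith) hr]
      linarith
  calc _ ≤ ∫⁻ y, (ENNReal.ofReal (posLog (2 / r))
      + S.indicator (fun _ => ENNReal.ofReal (log (1 / ε))) y
      + ENNReal.ofReal (posLog (ε / dist x y))) ∂μ := lintegral_mono hpt
    _ = ENNReal.ofReal (posLog (2 / r)) + ENNReal.ofReal (log (1 / ε)) * μ S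
      + ∫⁻ y, ENNReal.ofReal (posLog (ε / dist x y)) ∂μ := by
        rw [lintegral_add_right _ (by unfold posLog; fun_prop),
          lintegral_add_left measurable_const, lintegral_indicator hSm]
        simp
    _ ≤ ENNReal.ofReal (posLog (2 / r)) + ENNReal.ofReal M + 2 := by
        gcongr
        · rw [← ofReal_measureReal, ← ENNReal.ofReal_mul h0]
          exact ENNReal.ofReal_le_ofReal hM
        · exact lintegral_posLog_div_dist_le hε hμ x
    _ = _ := by
        rw [ENNReal.ofReal_add (add_nonneg posLog_nonneg hM0) (by norm_num),
          ENNReal.ofReal_add posLog_nonneg hM0]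
        simp

/-- Removing the mass of `μ` away from `a` lowers the energy by little. -/
theorem logEnergy_le_integral_restrict_add {μ : Measure E2} [IsProbabilityMeasure μ] {c : E2}
    {R ε r M : ℝ} (hK : μ (closedBall c R)ᶜ = 0)
    (hε : 0 < ε) (hε1 : ε ≤ 1) (hr : 0 < r)
    (hμ : μ ≤ ENNReal.ofReal (ε ^ 2)⁻¹ • volume) {a : E2}
    (hM : log (1 / ε) * μ.real {y | r / 2 ≤ dist y a} ≤ M) :
    logEnergy μ ≤ (∫ q, log (1 / dist q.1 q.2) ∂((μ.restrict (ball a r)).prod (μ.restrict (ball a r))))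
      + 2 * μ.real {y | r ≤ dist y a} * (posLog (2 / r) + M + 2) := by
  have h0 : 0 ≤ log (1 / ε) := log_nonneg (by rw [le_div_iff₀ hε]; linarith)
  have hM0 : 0 ≤ M := le_trans (by positivity) hM
  have hk0 : 0 ≤ posLog (2 / r) + M + 2 :=
    add_nonneg (add_nonneg posLog_nonneg hM0) (by norm_num)
  set k := posLog (2 / r) + M + 2
  set T := {y : E2 | r ≤ dist y a} with hT
  have hTm : MeasurableSet T := measurableSet_le measurable_const (by fun_prop)
  have hTA : (ball a r)ᶜ = T := by
    ext y; simp [hT]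
  have hl := integrable_log_one_div_dist hK hε hμ
  have hlp : Integrable (fun q : E2 × E2 => posLog (1 / dist q.1 q.2)) (μ.prod μ) := by
    refine hl.pos_part.congr (ae_of_all _ fun q => ?_)
    simp [posLog, max_comm]
  have hm : Measurable fun q : E2 × E2 => ENNReal.ofReal (posLog (1 / dist q.1 q.2)) :=
    (measurable_posLog_div_dist 1).ennreal_ofReal
  have hAm : MeasurableSet (ball a r ×ˢ ball a r) := measurableSet_ball.prod measurableSet_ball
  have hpt : ∀ x ∈ T, ∫⁻ y, ENNReal.ofReal (posLog (1 / dist x y)) ∂μ ≤ ENNReal.ofReal k :=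
    fun x hx => lintegral_posLog_one_div_dist_le hε hε1 hr hμ hx hM
  have h1 : ∫⁻ q in T ×ˢ Set.univ, ENNReal.ofReal (posLog (1 / dist q.1 q.2)) ∂(μ.prod μ)
      ≤ ENNReal.ofReal k * μ T := by
    rw [← Measure.prod_restrict, Measure.restrict_univ, lintegral_prod _ hm.aemeasurable]
    exact (setLIntegral_mono measurable_const hpt).trans (by simp)
  have h2 : ∫⁻ q in Set.univ ×ˢ T, ENNReal.ofReal (posLog (1 / dist q.1 q.2)) ∂(μ.prod μ)
      ≤ ENNReal.ofReal k * μ T := by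
    rw [← Measure.prod_restrict, Measure.restrict_univ, lintegral_prod_symm _ hm.aemeasurable]
    refine (setLIntegral_mono measurable_const fun x hx => ?_).trans
      (setLIntegral_const T _).le
    simpa only [dist_comm] using hpt x hx
  have hcompl : (ball a r ×ˢ ball a r)ᶜ ⊆ T ×ˢ Set.univ ∪ Set.univ ×ˢ T := by
    rw [← hTA]
    rintro ⟨x, y⟩ h
    simp only [Set.mem_compl_iff, Set.mem_prod, Set.mem_union, Set.mem_univ] at h ⊢
    tauto
  have h3 : ∫⁻ q in (ball a r ×ˢ ball a r)ᶜ,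
      ENNReal.ofReal (posLog (1 / dist q.1 q.2)) ∂(μ.prod μ) ≤ ENNReal.ofReal (2 * μ.real T * k) := by
    calc _ ≤ _ := lintegral_mono_set hcompl
      _ ≤ _ := lintegral_union_le _ _ _
      _ ≤ ENNReal.ofReal k * μ T + ENNReal.ofReal k * μ T := add_le_add h1 h2
      _ = _ := by
        rw [← ofReal_measureReal, ← ENNReal.ofReal_mul hk0,
          ← ENNReal.ofReal_add (by positivity) (by positivity)]
        congr 1
        ring
  rw [← ofReal_integral_eq_lintegral_ofReal hlp.integrableOn (ae_of_all _ fun _ => posLog_nonneg),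
    ENNReal.ofReal_le_ofReal_iff (by positivity)] at h3
  unfold logEnergy
  rw [← integral_add_compl hAm hl, Measure.prod_restrict]
  refine add_le_add_right (le_trans ?_ h3) _
  exact integral_mono hl.integrableOn hlp.integrableOn fun q => le_max_right _ _

theorem exists_measure_near_logEnergy_ge {μ : Measure E2} [IsProbabilityMeasure μ] {c : E2}
    {R ε r M : ℝ} (hK : μ (closedBall c R)ᶜ = 0)
    (hε : 0 < ε) (hεr : ε ≤ r) (hr1 : 6 * r ≤ 1)
    (hμ : μ ≤ ENNReal.ofReal (ε ^ 2)⁻¹ • volume) {a : E2}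
    (hM : log (1 / ε) * μ.real {y | r / 2 ≤ dist y a} ≤ M) (b : E2) :
    ∃ ν : Measure E2, IsProbabilityMeasure ν ∧ ν (closedBall b (3 * r))ᶜ = 0 ∧
      ν ≤ ENNReal.ofReal (ε ^ 2)⁻¹ • volume ∧
      logEnergy μ - 2 * μ.real {y | r ≤ dist y a} * (posLog (2 / r) + M + 2) ≤ logEnergy ν := by
  have hr : 0 < r := hε.trans_le hεr
  have hε1 : ε ≤ 1 := by linarith
  have hE := logEnergy_le_integral_restrict_add hK hε hε1 hr hμ hM
  set k := ENNReal.ofReal (ε ^ 2)⁻¹ with hk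
  set T := {y : E2 | r ≤ dist y a} with hT
  have hTA : (ball a r)ᶜ = T := by
    ext y; simp [hT]
  obtain ⟨v, hv⟩ : ∃ v : E2, ‖v‖ = 2 * r :=
    ⟨EuclideanSpace.single 0 (2 * r), by simp [abs_of_pos hr]⟩
  set f : E2 → E2 := fun x => x + (b - a) with hf
  have hfm : Measurable f := by fun_prop
  have hfp : MeasurePreserving f volume volume := measurePreserving_add_right _ _
  have hpre : f ⁻¹' ball b r = ball a r := by
    ext x
    simp only [hf, Set.mem_preimage, mem_ball, dist_eq_norm]
    rw [show x + (b - a) - b = x - a by abel]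
  set B := ball (b + v) r with hB
  have hvolB : volume B = ENNReal.ofReal (r ^ 2 * π) := by
    rw [hB, EuclideanSpace.volume_ball_fin_two, ← ENNReal.ofReal_pow hr.le,
      ← ENNReal.ofReal_mul (by positivity)]
  have hvolB0 : volume B ≠ 0 := by
    rw [hvolB]; simp; positivity
  have hvolBt : volume B ≠ ∞ := by rw [hvolB]; simp
  have hdisj : Disjoint (ball b r) B := by
    apply ball_disjoint_ball
    rw [dist_self_add_right, hv]; linarith
  set μ₁ := (μ.restrict (ball a r)).map f with hμ₁
  have hμ₁' : μ₁ = (μ.map f).restrict (ball b r) := by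
    rw [Measure.restrict_map hfm measurableSet_ball, hpre]
  set μ₂ : Measure E2 := (μ T / volume B) • volume.restrict B with hμ₂
  have hd1 : μ₁ ≤ k • volume.restrict (ball b r) := by
    rw [hμ₁', ← Measure.restrict_smul]
    apply Measure.restrict_mono le_rfl
    calc μ.map f ≤ (k • volume).map f := Measure.map_mono hμ hfm
      _ = k • volume := by rw [Measure.map_smul, hfp.map_eq]
  have hd2 : μ₂ ≤ k • volume.restrict B := by
    have : μ T / volume B ≤ k := by
      calc μ T / volume B ≤ 1 / volume B := by gcongr; exact prob_le_one
        _ ≤ k := by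
          rw [hvolB, one_div, ← ENNReal.ofReal_inv_of_pos (by positivity)]
          apply ENNReal.ofReal_le_ofReal
          have : ε ^ 2 ≤ r ^ 2 := by gcongr
          have : r ^ 2 * 1 ≤ r ^ 2 * π := by gcongr; linarith [pi_gt_three]
          gcongr
          linarith
    intro s
    simp only [hμ₂, Measure.smul_apply, smul_eq_mul]
    gcongr
  have hνd : μ₁ + μ₂ ≤ k • volume := by
    calc μ₁ + μ₂ ≤ k • volume.restrict (ball b r) + k • volume.restrict B := add_le_add hd1 hd2
      _ = k • volume.restrict (ball b r ∪ B) := by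
        rw [Measure.restrict_union hdisj measurableSet_ball, smul_add]
      _ ≤ k • volume := by
        intro s
        simp only [Measure.smul_apply, smul_eq_mul]
        gcongr
        exact Measure.restrict_le_self
  have hν1 : IsProbabilityMeasure (μ₁ + μ₂) := by
    constructor
    rw [Measure.add_apply, hμ₁, Measure.map_apply hfm MeasurableSet.univ, Set.preimage_univ,
      Measure.restrict_apply_univ, hμ₂, Measure.smul_apply, Measure.restrict_apply_univ,
      smul_eq_mul, ENNReal.div_mul_cancel hvolB0 hvolBt, ← hTA]
    rw [measure_add_measure_compl measurableSet_ball, measure_univ]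
  have hνK : (μ₁ + μ₂) (closedBall b (3 * r))ᶜ = 0 := by
    have s1 : ball b r ⊆ closedBall b (3 * r) :=
      ball_subset_closedBall.trans (closedBall_subset_closedBall (by linarith))
    have s2 : B ⊆ closedBall b (3 * r) := by
      refine ball_subset_closedBall.trans (closedBall_subset_closedBall' ?_)
      rw [dist_self_add_left, hv]; linarith
    rw [Measure.add_apply, hμ₁', hμ₂, Measure.smul_apply,
      Measure.restrict_apply measurableSet_closedBall.compl,
      Measure.restrict_apply measurableSet_closedBall.compl]
    rw [Set.disjoint_iff_inter_eq_empty.1 (Set.disjoint_compl_left_iff_subset.2 s1),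
      Set.disjoint_iff_inter_eq_empty.1 (Set.disjoint_compl_left_iff_subset.2 s2)]
    simp
  refine ⟨μ₁ + μ₂, hν1, hνK, hνd, ?_⟩
  suffices h : ∫ q, log (1 / dist q.1 q.2) ∂((μ.restrict (ball a r)).prod (μ.restrict (ball a r)))
      ≤ logEnergy (μ₁ + μ₂) by linarith
  have hmeas : Measurable fun q : E2 × E2 => log (1 / dist q.1 q.2) := by fun_prop
  have heq : ∫ q, log (1 / dist q.1 q.2) ∂((μ.restrict (ball a r)).prod (μ.restrict (ball a r)))
      = ∫ q, log (1 / dist q.1 q.2) ∂(μ₁.prod μ₁) := by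
    rw [hμ₁, Measure.map_prod_map _ _ hfm hfm,
      integral_map (hfm.prodMap hfm).aemeasurable hmeas.aestronglyMeasurable]
    simp [hf]
  rw [heq]
  have hle : μ₁ ≤ μ₁ + μ₂ := Measure.le_add_right le_rfl
  refine integral_mono_measure (Measure.prod_mono hle hle) ?_
    (integrable_log_one_div_dist hνK hε hνd)
  filter_upwards [ae_prod_mem hνK hνK] with q ⟨h1, h2⟩
  rw [mem_closedBall] at h1 h2
  have := dist_triangle_right q.1 q.2 b
  change 0 ≤ log (1 / dist q.1 q.2)
  rw [one_div, log_inv, neg_nonneg]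
  exact log_nonpos dist_nonneg (by linarith)

theorem tendsto_log_div_nhdsGT_zero {r : ℝ} (hr : 0 < r) :
    Tendsto (fun ε : ℝ => log (r / ε)) (𝓝[>] 0) atTop := by
  have h : Tendsto (fun ε : ℝ => r / ε) (𝓝[>] 0) atTop := by
    simpa only [div_eq_mul_inv] using tendsto_inv_nhdsGT_zero.const_mul_atTop hr
  exact tendsto_log_atTop.comp h

theorem eventually_exists_concentrated (C R : ℝ) {r : ℝ} (hr : 0 < r) :
    ∀ᶠ ε : ℝ in 𝓝[>] 0, ∀ (μ : Measure E2) (c : E2), IsProbabilityMeasure μ →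
      μ (closedBall c R)ᶜ = 0 → μ ≤ ENNReal.ofReal (ε ^ 2)⁻¹ • volume →
      log (1 / ε) - C ≤ logEnergy μ →
      ∃ a ∈ closedBall c R, μ.real {x | r ≤ dist x a} ≤ r ∧
        log (1 / ε) * μ.real {x | r ≤ dist x a} ≤ C + 2 + |log r| := by
  filter_upwards [self_mem_nhdsWithin,
    mem_nhdsWithin_of_mem_nhds (Iio_mem_nhds hr), mem_nhdsWithin_of_mem_nhds (Iio_mem_nhds one_pos),
    (tendsto_log_div_nhdsGT_zero hr).eventually_ge_atTop ((C + 2) / r)]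
    with ε hε hεr hε1 hlog μ c hμ1 hK hμ hC
  simp only [Set.mem_Ioi, Set.mem_Iio] at hε hεr hε1
  obtain ⟨a, ha, h⟩ := exists_mul_measureReal_le hK hε hεr hε1.le hμ hC
  have hpos : 0 < log (r / ε) := log_pos (by rwa [one_lt_div hε])
  refine ⟨a, ha, ?_, ?_⟩
  · rw [div_le_iff₀ hr] at hlog
    have : log (r / ε) * μ.real {x | r ≤ dist x a} ≤ log (r / ε) * r := h.trans hlog
    exact le_of_mul_le_mul_left this hpos
  · have e : log (1 / ε) = log (r / ε) - log r := by
      rw [log_div hr.ne' hε.ne', one_div, log_inv]; ring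
    have h1 : μ.real {x | r ≤ dist x a} ≤ 1 := measureReal_le_one
    have h0 : 0 ≤ μ.real {x | r ≤ dist x a} := measureReal_nonneg
    have : -log r * μ.real {x | r ≤ dist x a} ≤ |log r| * 1 := by
      gcongr
      exact neg_le_abs _
    rw [e]
    linarith

theorem eventually_exists_near_logEnergy_ge (C R : ℝ) {ρ τ : ℝ} (hρ : 0 < ρ) (hτ : 0 < τ) :
    ∀ᶠ ε : ℝ in 𝓝[>] 0, ∀ (μ : Measure E2) (c b : E2), IsProbabilityMeasure μ →
      μ (closedBall c R)ᶜ = 0 → μ ≤ ENNReal.ofReal (ε ^ 2)⁻¹ • volume →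
      log (1 / ε) - C ≤ logEnergy μ →
      ∃ ν : Measure E2, IsProbabilityMeasure ν ∧ ν (closedBall b ρ)ᶜ = 0 ∧
        ν ≤ ENNReal.ofReal (ε ^ 2)⁻¹ • volume ∧ logEnergy μ - τ ≤ logEnergy ν := by
  obtain ⟨r, hr, hr1, hrρ⟩ : ∃ r : ℝ, 0 < r ∧ 6 * r ≤ 1 ∧ 3 * r ≤ ρ :=
    ⟨min ρ 1 / 6, by positivity, by linarith [min_le_right ρ 1], by linarith [min_le_left ρ 1]⟩
  set M := C + 2 + |log (r / 2)| with hMdef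
  filter_upwards [self_mem_nhdsWithin, mem_nhdsWithin_of_mem_nhds (Iio_mem_nhds hr),
    eventually_exists_concentrated C R (half_pos hr),
    (tendsto_log_div_nhdsGT_zero one_pos).eventually_ge_atTop
      (max 1 (2 * M * (posLog (2 / r) + M + 2) / τ))]
    with ε hε hεr hconc hlog μ c b hμ1 hK hμ hC
  simp only [Set.mem_Ioi, Set.mem_Iio] at hε hεr
  obtain ⟨a, ha, -, hM⟩ := hconc μ c hμ1 hK hμ hC
  obtain ⟨ν, hν1, hνK, hνd, hνE⟩ := exists_measure_near_logEnergy_ge hK hε hεr.le hr1 hμ hM b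
  refine ⟨ν, hν1, measure_mono_null
    (Set.compl_subset_compl.2 (closedBall_subset_closedBall hrρ)) hνK, hνd, ?_⟩
  have hl1 : 0 < log (1 / ε) := lt_of_lt_of_le one_pos ((le_max_left _ _).trans hlog)
  have hM0 : 0 ≤ M := le_trans (by positivity) hM
  have hk0 : 0 ≤ posLog (2 / r) + M + 2 :=
    add_nonneg (add_nonneg posLog_nonneg hM0) (by norm_num)
  have hmono : μ.real {y | r ≤ dist y a} ≤ μ.real {y | r / 2 ≤ dist y a} :=
    measureReal_mono fun y (hy : r ≤ dist y a) => show r / 2 ≤ dist y a by linarith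
  have hlog2 := (le_max_right _ _).trans hlog
  rw [div_le_iff₀ hτ] at hlog2
  have h1 : log (1 / ε) * μ.real {y | r ≤ dist y a} ≤ M :=
    (mul_le_mul_of_nonneg_left hmono hl1.le).trans hM
  have h2 : log (1 / ε) * (2 * μ.real {y | r ≤ dist y a} * (posLog (2 / r) + M + 2))
      ≤ log (1 / ε) * τ := by
    have := mul_le_mul_of_nonneg_right h1 hk0
    linarith
  have := le_of_mul_le_mul_left h2 hl1
  linarith

theorem exists_measure_logEnergy_ge (b : E2) {ε : ℝ} (hε : 0 < ε) :
    ∃ ν : Measure E2, IsProbabilityMeasure ν ∧ ν (closedBall b ε)ᶜ = 0 ∧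
      ν ≤ ENNReal.ofReal (ε ^ 2)⁻¹ • volume ∧ log (1 / ε) - 1 ≤ logEnergy ν := by
  have hvol : volume (ball b ε) = ENNReal.ofReal (ε ^ 2 * π) := by
    rw [EuclideanSpace.volume_ball_fin_two, ← ENNReal.ofReal_pow hε.le,
      ← ENNReal.ofReal_mul (by positivity)]
  have hvol0 : volume (ball b ε) ≠ 0 := by
    rw [hvol]; simp; positivity
  have hvolt : volume (ball b ε) ≠ ∞ := by rw [hvol]; simp
  set ν : Measure E2 := (volume (ball b ε))⁻¹ • volume.restrict (ball b ε) with hν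
  have hν1 : IsProbabilityMeasure ν := by
    constructor
    rw [hν, Measure.smul_apply, Measure.restrict_apply_univ, smul_eq_mul,
      ENNReal.inv_mul_cancel hvol0 hvolt]
  have hνK : ν (closedBall b ε)ᶜ = 0 := by
    rw [hν, Measure.smul_apply, Measure.restrict_apply measurableSet_closedBall.compl,
      Set.disjoint_iff_inter_eq_empty.1 (Set.disjoint_compl_left_iff_subset.2 ball_subset_closedBall)]
    simp
  have hνd : ν ≤ ENNReal.ofReal (ε ^ 2)⁻¹ • volume := by
    intro s
    simp only [hν, Measure.smul_apply, smul_eq_mul]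
    gcongr
    · rw [hvol, ← ENNReal.ofReal_inv_of_pos (by positivity)]
      apply ENNReal.ofReal_le_ofReal
      have : ε ^ 2 * 1 ≤ ε ^ 2 * π := by gcongr; linarith [pi_gt_three]
      gcongr
      linarith
    · exact Measure.restrict_le_self
  refine ⟨ν, hν1, hνK, hνd, ?_⟩
  have hl := integrable_log_one_div_dist hνK hε hνd
  have hdiag : ∀ᵐ q ∂(ν.prod ν), q.1 ≠ q.2 := by
    have hν0 : ∀ x, ν {x} = 0 := fun x => by
      have := hνd {x}
      simpa using this
    rw [Measure.ae_prod_iff_ae_ae (by measurability)]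
    refine ae_of_all _ fun x => ?_
    rw [ae_iff]
    convert hν0 x using 2
    ext y; simp [eq_comm]
  have : ∫ _ : E2 × E2, (log (1 / ε) - 1) ∂(ν.prod ν) ≤ logEnergy ν := by
    refine integral_mono_ae (integrable_const _) hl ?_
    filter_upwards [ae_prod_mem hνK hνK, hdiag] with q ⟨h1, h2⟩ h3
    rw [mem_closedBall] at h1 h2
    have hd := dist_triangle_right q.1 q.2 b
    have hpos : 0 < dist q.1 q.2 := dist_pos.2 h3
    rw [one_div, log_inv, one_div, log_inv]
    have h4 : log (dist q.1 q.2) ≤ log (2 * ε) := log_le_log hpos (by linarith)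
    rw [log_mul (by norm_num) hε.ne'] at h4
    have := log_two_lt_d9
    linarith
  simpa using this

theorem ContinuousOn.integrable_prod_of_isCompact {K K' : Set E2} (hK : IsCompact K)
    (hK' : IsCompact K') {g : E2 × E2 → ℝ} (hg : ContinuousOn g (K ×ˢ K')) {P Q : Measure E2}
    [IsProbabilityMeasure P] [IsProbabilityMeasure Q] (hP : P Kᶜ = 0) (hQ : Q K'ᶜ = 0) :
    Integrable g (P.prod Q) := by
  have h := hg.integrableOn_compact (μ := P.prod Q) (hK.prod hK')
  have hmem : ∀ᵐ q ∂(P.prod Q), q ∈ K ×ˢ K' := ae_prod_mem hP hQ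
  rwa [IntegrableOn, Measure.restrict_eq_self_of_ae_mem hmem] at h

theorem eventually_abs_integral_prod_sub_le {K K' : Set E2} (hK : IsCompact K)
    (hK' : IsCompact K') {g : E2 × E2 → ℝ} (hg : ContinuousOn g (K ×ˢ K')) {τ : ℝ} (hτ : 0 < τ) :
    ∀ᶠ r : ℝ in 𝓝[>] 0, ∀ (P Q : Measure E2) (a b : E2), IsProbabilityMeasure P →
      IsProbabilityMeasure Q → P Kᶜ = 0 → Q K'ᶜ = 0 → a ∈ K → b ∈ K' →
      P.real {x | r ≤ dist x a} ≤ r → Q.real {x | r ≤ dist x b} ≤ r →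
      |∫ q, g q ∂(P.prod Q) - g (a, b)| ≤ τ := by
  have huc := (hK.prod hK').uniformContinuousOn_of_continuous hg
  rw [Metric.uniformContinuousOn_iff] at huc
  obtain ⟨s, hs, huc⟩ := huc (τ / 2) (half_pos hτ)
  obtain ⟨M, hM⟩ := (hK.prod hK').exists_bound_of_continuousOn hg
  filter_upwards [self_mem_nhdsWithin, mem_nhdsWithin_of_mem_nhds (Iio_mem_nhds hs),
    mem_nhdsWithin_of_mem_nhds (Iio_mem_nhds
      (show 0 < τ / (8 * (|M| + 1)) by positivity))]
    with r hr hrs hrM P Q a b hP1 hQ1 hP hQ ha hb hPa hQb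
  simp only [Set.mem_Ioi, Set.mem_Iio] at hr hrs hrM
  rw [lt_div_iff₀ (by positivity)] at hrM
  have hab : (a, b) ∈ K ×ˢ K' := ⟨ha, hb⟩
  have hGint := hg.integrable_prod_of_isCompact hK hK' hP hQ
  set S := {x : E2 | r ≤ dist x a} with hS
  set T := {x : E2 | r ≤ dist x b} with hT
  have hSm : MeasurableSet (S ×ˢ (Set.univ : Set E2)) :=
    (measurableSet_le measurable_const (by fun_prop)).prod MeasurableSet.univ
  have hTm : MeasurableSet ((Set.univ : Set E2) ×ˢ T) :=
    MeasurableSet.univ.prod (measurableSet_le measurable_const (by fun_prop))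
  set F : E2 × E2 → ℝ := fun q => τ / 2 +
    ((S ×ˢ Set.univ).indicator (fun _ => 2 * |M|) q + (Set.univ ×ˢ T).indicator (fun _ => 2 * |M|) q)
    with hF
  have i1 : Integrable ((S ×ˢ (Set.univ : Set E2)).indicator fun _ => 2 * |M|) (P.prod Q) :=
    (integrable_const _).indicator hSm
  have i2 : Integrable (((Set.univ : Set E2) ×ˢ T).indicator fun _ => 2 * |M|) (P.prod Q) :=
    (integrable_const _).indicator hTm
  have i12 : Integrable (fun q => (S ×ˢ (Set.univ : Set E2)).indicator (fun _ => 2 * |M|) q +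
    ((Set.univ : Set E2) ×ˢ T).indicator (fun _ => 2 * |M|) q) (P.prod Q) := i1.add i2
  have hFi : Integrable F (P.prod Q) := (integrable_const _).add i12
  have hFle : ∫ q, F q ∂(P.prod Q) ≤ τ := by
    simp only [hF]
    rw [integral_add (integrable_const _) i12, integral_add i1 i2, integral_indicator hSm,
      integral_indicator hTm, setIntegral_const, setIntegral_const, measureReal_prod_prod,
      measureReal_prod_prod]
    simp only [integral_const, probReal_univ, smul_eq_mul, one_mul, mul_one]
    have h1 : P.real S * (2 * |M|) ≤ r * (2 * |M|) := by gcongr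
    have h2 : Q.real T * (2 * |M|) ≤ r * (2 * |M|) := by gcongr
    linarith
  have hpt : ∀ᵐ q ∂(P.prod Q), ‖g q - g (a, b)‖ ≤ F q := by
    filter_upwards [ae_prod_mem hP hQ] with q hq
    have hcst : ‖g q - g (a, b)‖ ≤ 2 * |M| := by
      have := norm_sub_le (g q) (g (a, b))
      have := hM q hq
      have := hM _ hab
      have := le_abs_self M
      linarith
    have n1 : 0 ≤ (S ×ˢ (Set.univ : Set E2)).indicator (fun _ => 2 * |M|) q :=
      Set.indicator_nonneg (fun _ _ => by positivity) _
    have n2 : 0 ≤ ((Set.univ : Set E2) ×ˢ T).indicator (fun _ => 2 * |M|) q :=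
      Set.indicator_nonneg (fun _ _ => by positivity) _
    simp only [hF]
    by_cases h1 : q ∈ S ×ˢ (Set.univ : Set E2)
    · rw [Set.indicator_of_mem h1]
      linarith
    by_cases h2 : q ∈ (Set.univ : Set E2) ×ˢ T
    · rw [Set.indicator_of_mem h2]
      linarith
    · have h3 : dist q (a, b) < s := by
        simp only [hS, hT, Set.mem_prod, Set.mem_univ, and_true, true_and, Set.mem_ofPred_eq,
          not_le] at h1 h2
        rw [Prod.dist_eq]
        exact max_lt (h1.trans hrs) (h2.trans hrs)
      have := huc q hq _ hab h3
      rw [Real.dist_eq] at this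
      rw [norm_eq_abs]
      linarith
  have h := norm_integral_le_of_norm_le hFi hpt
  rw [integral_sub hGint (integrable_const _)] at h
  simp only [integral_const, probReal_univ, smul_eq_mul, one_mul, norm_eq_abs] at h
  exact h.trans hFle

/-- Near-maximizers of a continuous function with a unique maximum are near the maximum point. -/
theorem exists_pos_forall_dist_lt {X : Type*} [PseudoMetricSpace X] {K : Set X} (hK : IsCompact K)
    {W : X → ℝ} (hW : ContinuousOn W K) {x₀ : X} (hmax : ∀ y ∈ K, y ≠ x₀ → W y < W x₀)
    {η : ℝ} (hη : 0 < η) : ∃ τ > 0, ∀ y ∈ K, W x₀ - τ ≤ W y → dist y x₀ < η := by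
  have hS : IsCompact (K ∩ {y | η ≤ dist y x₀}) :=
    hK.inter_right (isClosed_le continuous_const (by fun_prop))
  rcases (K ∩ {y | η ≤ dist y x₀}).eq_empty_or_nonempty with h | h
  · refine ⟨1, one_pos, fun y hy _ => ?_⟩
    by_contra! hd
    exact (Set.eq_empty_iff_forall_notMem.1 h y) ⟨hy, hd⟩
  · obtain ⟨y₀, hy₀, hm⟩ := hS.exists_isMaxOn h (hW.mono Set.inter_subset_left)
    have hne : y₀ ≠ x₀ := by
      rintro rfl
      have : η ≤ dist y₀ y₀ := hy₀.2
      rw [dist_self] at this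
      linarith
    have hlt := hmax y₀ hy₀.1 hne
    refine ⟨(W x₀ - W y₀) / 2, by linarith, fun y hy hWy => ?_⟩
    by_contra! hd
    have : W y ≤ W y₀ := hm ⟨hy, hd⟩
    linarith

/-- The probability laws of `p` patches and `l` point vortices. -/
def vortexLaw {p l : ℕ} (μ : Fin p → Measure E2) (z : Fin l → E2) : Fin (p + l) → Measure E2 :=
  Fin.append μ fun j => Measure.dirac (z j)

/-- The energy of a system of patches and point vortices, split into the singular self-interaction
of the patches and a regular interaction `g`. -/
def vortexEnergy {p l : ℕ} (κ : Fin (p + l) → ℝ) (g : Fin (p + l) → Fin (p + l) → E2 × E2 → ℝ)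
    (μ : Fin p → Measure E2) (z : Fin l → E2) : ℝ :=
  ∑ i, κ (Fin.castAdd l i) ^ 2 / (4 * π) * logEnergy (μ i) +
    1 / 2 * ∑ i, ∑ j, ∫ q, g i j q ∂((vortexLaw μ z i).prod (vortexLaw μ z j))

/-- Admissible normalized patches and point vortices. -/
structure VortexAdmissible {p l : ℕ} (κ : Fin (p + l) → ℝ) (xb : Fin (p + l) → E2) (δ lam : ℝ)
    (μ : Fin p → Measure E2) (z : Fin l → E2) : Prop where
  isProb : ∀ i, IsProbabilityMeasure (μ i)
  null : ∀ i, μ i (ball (xb (Fin.castAdd l i)) δ)ᶜ = 0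
  le : ∀ i, μ i ≤ ENNReal.ofReal (lam / |κ (Fin.castAdd l i)|) • volume
  mem : ∀ j, z j ∈ closedBall (xb (Fin.natAdd p j)) δ

section VortexLaw

variable {p l : ℕ} {κ : Fin (p + l) → ℝ} {xb : Fin (p + l) → E2} {δ lam : ℝ}
  {μ : Fin p → Measure E2} {z : Fin l → E2}

theorem VortexAdmissible.isProbabilityMeasure (h : VortexAdmissible κ xb δ lam μ z)
    (i : Fin (p + l)) : IsProbabilityMeasure (vortexLaw μ z i) := by
  refine Fin.addCases (fun i => ?_) (fun j => ?_) i
  · simpa [vortexLaw] using h.isProb i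
  · simp only [vortexLaw, Fin.append_right]
    infer_instance

theorem VortexAdmissible.null_closedBall (h : VortexAdmissible κ xb δ lam μ z) (i : Fin p) :
    μ i (closedBall (xb (Fin.castAdd l i)) δ)ᶜ = 0 :=
  measure_mono_null (Set.compl_subset_compl.2 ball_subset_closedBall) (h.null i)

theorem VortexAdmissible.law_null (h : VortexAdmissible κ xb δ lam μ z)
    (i : Fin (p + l)) : vortexLaw μ z i (closedBall (xb i) δ)ᶜ = 0 := by
  refine Fin.addCases (fun i => ?_) (fun j => ?_) i
  · simpa [vortexLaw] using h.null_closedBall i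
  · simpa [vortexLaw] using h.mem j

theorem vortexLaw_real_le {a : Fin p → E2} {r : ℝ} (hr : 0 < r)
    (h : ∀ i, (μ i).real {x | r ≤ dist x (a i)} ≤ r) (i : Fin (p + l)) :
    (vortexLaw μ z i).real {x | r ≤ dist x (Fin.append a z i)} ≤ r := by
  refine Fin.addCases (fun i => ?_) (fun j => ?_) i
  · simpa [vortexLaw] using h i
  · have : z j ∉ {x | r ≤ dist x (z j)} := by simpa using hr
    have hm : MeasurableSet {x | r ≤ dist x (z j)} :=
      measurableSet_le measurable_const (by fun_prop)
    simp [vortexLaw, Measure.real, Measure.dirac_apply' _ hm, this, hr.le]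

end VortexLaw

theorem tendsto_sqrt_div_atTop {c : ℝ} (hc : 0 < c) :
    Tendsto (fun lam : ℝ => √(c / lam)) atTop (𝓝[>] 0) := by
  refine tendsto_nhdsWithin_iff.2 ⟨?_, ?_⟩
  · have h : Tendsto (fun lam : ℝ => c / lam) atTop (𝓝 0) := tendsto_const_nhds.div_atTop tendsto_id
    simpa using h.sqrt
  · filter_upwards [eventually_gt_atTop 0] with lam hlam
    exact sqrt_pos.2 (by positivity)

theorem inv_sq_sqrt_div {c lam : ℝ} (hc : 0 < c) (hlam : 0 < lam) :
    (√(c / lam) ^ 2)⁻¹ = lam / c := by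
  rw [sq_sqrt (by positivity), inv_div]

section Maximizers

variable {p l : ℕ} {κ : Fin (p + l) → ℝ} {xb : Fin (p + l) → E2} {δ : ℝ}
  {g : Fin (p + l) → Fin (p + l) → E2 × E2 → ℝ}

theorem exists_abs_interaction_le
    (hg : ∀ i j, ContinuousOn (g i j) (closedBall (xb i) δ ×ˢ closedBall (xb j) δ)) :
    ∃ B : ℝ, ∀ (lam : ℝ) (μ : Fin p → Measure E2) (z : Fin l → E2),
      VortexAdmissible κ xb δ lam μ z →
      |1 / 2 * ∑ i, ∑ j, ∫ q, g i j q ∂((vortexLaw μ z i).prod (vortexLaw μ z j))| ≤ B := by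
  choose M hM using fun i j => ((isCompact_closedBall (xb i) δ).prod
    (isCompact_closedBall (xb j) δ)).exists_bound_of_continuousOn (hg i j)
  refine ⟨1 / 2 * ∑ i, ∑ j, M i j, fun lam μ z h => ?_⟩
  rw [abs_mul, abs_of_pos (by norm_num : (0 : ℝ) < 1 / 2)]
  gcongr
  refine (Finset.abs_sum_le_sum_abs _ _).trans (Finset.sum_le_sum fun i _ => ?_)
  refine (Finset.abs_sum_le_sum_abs _ _).trans (Finset.sum_le_sum fun j _ => ?_)
  have := h.isProbabilityMeasure i
  have := h.isProbabilityMeasure j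
  have hb := norm_integral_le_of_norm_le_const (C := M i j)
    ((ae_prod_mem (h.law_null i) (h.law_null j)).mono fun q hq => hM i j q hq)
  simpa using hb

/-- The patches of a maximizer have almost maximal logarithmic energy. -/
theorem exists_eventually_logEnergy_ge (hδ : 0 < δ) (hκ : ∀ i, κ i ≠ 0)
    (hg : ∀ i j, ContinuousOn (g i j) (closedBall (xb i) δ ×ˢ closedBall (xb j) δ)) :
    ∃ C : Fin p → ℝ, ∀ᶠ lam : ℝ in atTop, ∀ (μ : Fin p → Measure E2) (z : Fin l → E2),
      VortexAdmissible κ xb δ lam μ z →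
      (∀ μ' z', VortexAdmissible κ xb δ lam μ' z' →
        vortexEnergy κ g μ' z' ≤ vortexEnergy κ g μ z) →
      ∀ i, log (1 / √(|κ (Fin.castAdd l i)| / lam)) - C i ≤ logEnergy (μ i) := by
  obtain ⟨B, hB⟩ := exists_abs_interaction_le (κ := κ) hg
  set s : Fin p → ℝ := fun i => κ (Fin.castAdd l i) ^ 2 / (4 * π) with hs
  have hs0 : ∀ i, 0 < s i := fun i => by have := hκ (Fin.castAdd l i); positivity
  have hk0 : ∀ i : Fin p, 0 < |κ (Fin.castAdd l i)| := fun i => abs_pos.2 (hκ _)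
  refine ⟨fun i => (∑ i, s i * 3 + 2 * B) / s i, ?_⟩
  have hsmall : ∀ᶠ lam : ℝ in atTop, ∀ i : Fin p,
      √(|κ (Fin.castAdd l i)| / lam) ∈ Set.Ioo 0 (min 1 δ) :=
    eventually_all.2 fun i => (tendsto_sqrt_div_atTop (hk0 i)).eventually
      (Ioo_mem_nhdsGT (by positivity))
  filter_upwards [eventually_gt_atTop 0, hsmall] with lam hlam hsmall μ z hμ hmax i
  set ε : Fin p → ℝ := fun i => √(|κ (Fin.castAdd l i)| / lam) with hε
  have hdens : ∀ i, (ε i ^ 2)⁻¹ = lam / |κ (Fin.castAdd l i)| :=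
    fun i => inv_sq_sqrt_div (hk0 i) hlam
  choose ν hν1 hνK hνd hνE using fun i : Fin p =>
    exists_measure_logEnergy_ge (xb (Fin.castAdd l i)) (hsmall i).1
  have hν : VortexAdmissible κ xb δ lam ν fun j => xb (Fin.natAdd p j) :=
    { isProb := hν1
      null := fun i => measure_mono_null (Set.compl_subset_compl.2
        (closedBall_subset_ball ((hsmall i).2.trans_le (min_le_right _ _)))) (hνK i)
      le := fun i => by rw [← hdens]; exact hνd i
      mem := fun j => mem_closedBall_self hδ.le }
  have hcmp := hmax _ _ hν
  have b1 := abs_le.1 (hB _ _ _ hν)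
  have b2 := abs_le.1 (hB _ _ _ hμ)
  unfold vortexEnergy at hcmp
  have hlow : ∑ i, s i * (log (1 / ε i) - 1) ≤ ∑ i, s i * logEnergy (ν i) :=
    Finset.sum_le_sum fun i _ => mul_le_mul_of_nonneg_left (hνE i) (hs0 i).le
  have hd : ∀ i, 0 ≤ s i * (log (1 / ε i) + 2 - logEnergy (μ i)) := fun i => by
    have := hμ.isProb i
    refine mul_nonneg (hs0 i).le (sub_nonneg.2 ?_)
    exact logEnergy_le (hμ.null_closedBall i) (hsmall i).1
      ((hsmall i).2.le.trans (min_le_left _ _)) (by rw [hdens]; exact hμ.le i)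
  have hsum : ∑ i, s i * (log (1 / ε i) + 2 - logEnergy (μ i)) ≤ ∑ i, s i * 3 + 2 * B := by
    have : ∑ i, s i * (log (1 / ε i) + 2 - logEnergy (μ i)) =
        ∑ i, s i * (log (1 / ε i) - 1) + ∑ i, s i * 3 - ∑ i, s i * logEnergy (μ i) := by
      rw [← Finset.sum_add_distrib, ← Finset.sum_sub_distrib]
      exact Finset.sum_congr rfl fun i _ => by ring
    rw [this]
    linarith
  have hi := (Finset.single_le_sum (fun i _ => hd i) (Finset.mem_univ i)).trans hsum
  rw [mul_comm, ← le_div_iff₀ (hs0 i)] at hi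
  linarith

theorem abs_interaction_sub_le {τ r lam : ℝ} (hr : 0 < r)
    (hτ : ∀ i j, ∀ (P Q : Measure E2) (a b : E2), IsProbabilityMeasure P →
      IsProbabilityMeasure Q → P (closedBall (xb i) δ)ᶜ = 0 → Q (closedBall (xb j) δ)ᶜ = 0 →
      a ∈ closedBall (xb i) δ → b ∈ closedBall (xb j) δ →
      P.real {x | r ≤ dist x a} ≤ r → Q.real {x | r ≤ dist x b} ≤ r →
      |∫ q, g i j q ∂(P.prod Q) - g i j (a, b)| ≤ τ)
    {μ : Fin p → Measure E2} {z : Fin l → E2} (h : VortexAdmissible κ xb δ lam μ z)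
    {a : Fin p → E2} (ha : ∀ i, a i ∈ closedBall (xb (Fin.castAdd l i)) δ)
    (hμa : ∀ i, (μ i).real {x | r ≤ dist x (a i)} ≤ r) :
    |1 / 2 * ∑ i, ∑ j, ∫ q, g i j q ∂((vortexLaw μ z i).prod (vortexLaw μ z j)) -
      1 / 2 * ∑ i, ∑ j, g i j (Fin.append a z i, Fin.append a z j)| ≤
      1 / 2 * ((p + l : ℕ) ^ 2 * τ) := by
  have hmem : ∀ i, Fin.append a z i ∈ closedBall (xb i) δ := by
    refine Fin.addCases (fun i => ?_) (fun j => ?_)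
    · simpa using ha i
    · simpa using h.mem j
  rw [← mul_sub, abs_mul, abs_of_pos (by norm_num : (0 : ℝ) < 1 / 2)]
  gcongr
  simp only [← Finset.sum_sub_distrib]
  calc _ ≤ ∑ i : Fin (p + l), ∑ j : Fin (p + l), τ := by
        refine (Finset.abs_sum_le_sum_abs _ _).trans (Finset.sum_le_sum fun i _ => ?_)
        refine (Finset.abs_sum_le_sum_abs _ _).trans (Finset.sum_le_sum fun j _ => ?_)
        exact hτ i j _ _ _ _ (h.isProbabilityMeasure i) (h.isProbabilityMeasure j) (h.law_null i)
          (h.law_null j) (hmem i) (hmem j) (vortexLaw_real_le hr hμa i) (vortexLaw_real_le hr hμa j)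
    _ = _ := by
        simp only [Finset.sum_const, Finset.card_univ, Fintype.card_fin, nsmul_eq_mul]
        ring

theorem dist_integral_le {P : Measure E2} [IsProbabilityMeasure P] {c a : E2} {r : ℝ}
    (hP : P (closedBall c δ)ᶜ = 0) (ha : a ∈ closedBall c δ)
    (hPa : P.real {x | r ≤ dist x a} ≤ r) (hδ : 0 ≤ δ) (hr : 0 ≤ r) :
    dist (∫ x, x ∂P) a ≤ r * (1 + 2 * δ) := by
  have hae : ∀ᵐ x ∂P, x ∈ closedBall c δ := hP
  have hid : Integrable (fun x : E2 => x) P := by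
    refine Integrable.of_bound (by fun_prop) (‖c‖ + δ) (hae.mono fun x hx => ?_)
    have := norm_sub_norm_le x c
    rw [mem_closedBall, dist_eq_norm] at hx
    linarith
  have hSm : MeasurableSet {x | r ≤ dist x a} := measurableSet_le measurable_const (by fun_prop)
  have hI : Integrable ({x | r ≤ dist x a}.indicator fun _ => 2 * δ) P :=
    (integrable_const _).indicator hSm
  have hb : ∀ᵐ x ∂P, ‖x - a‖ ≤ r + {x | r ≤ dist x a}.indicator (fun _ => 2 * δ) x := by
    filter_upwards [hae] with x hx
    rw [← dist_eq_norm]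
    by_cases h : x ∈ {x | r ≤ dist x a}
    · rw [Set.indicator_of_mem h]
      rw [mem_closedBall] at hx ha
      have := dist_triangle_right x a c
      linarith
    · rw [Set.indicator_of_notMem h, add_zero]
      exact (not_le.1 h).le
  have h := norm_integral_le_of_norm_le ((integrable_const r).add hI) hb
  rw [integral_sub hid (integrable_const _)] at h
  simp only [Pi.add_apply] at h
  rw [integral_add (integrable_const _) hI, integral_indicator hSm, setIntegral_const] at h
  simp only [integral_const, probReal_univ, smul_eq_mul, one_smul, one_mul] at h
  rw [dist_eq_norm]
  have : P.real {x | r ≤ dist x a} * (2 * δ) ≤ r * (2 * δ) := by gcongr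
  linarith

/-- Maximizers of the vortex energy concentrate at the maximum point of the interaction. -/
theorem eventually_maximizers_near (hδ : 0 < δ) (hκ : ∀ i, κ i ≠ 0)
    (hg : ∀ i j, ContinuousOn (g i j) (closedBall (xb i) δ ×ˢ closedBall (xb j) δ))
    (hmax : ∀ y : Fin (p + l) → E2, (∀ i, y i ∈ closedBall (xb i) δ) → y ≠ xb →
      ∑ i, ∑ j, g i j (y i, y j) < ∑ i, ∑ j, g i j (xb i, xb j))
    {η : ℝ} (hη : 0 < η) :
    ∀ᶠ lam : ℝ in atTop, ∀ (μ : Fin p → Measure E2) (z : Fin l → E2),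
      VortexAdmissible κ xb δ lam μ z →
      (∀ μ' z', VortexAdmissible κ xb δ lam μ' z' →
        vortexEnergy κ g μ' z' ≤ vortexEnergy κ g μ z) →
      (∀ i, dist (∫ x, x ∂(μ i)) (xb (Fin.castAdd l i)) < η) ∧
      ∀ j, dist (z j) (xb (Fin.natAdd p j)) < η := by
  have hWc : ContinuousOn (fun y : Fin (p + l) → E2 => ∑ i, ∑ j, g i j (y i, y j))
      (Set.univ.pi fun i => closedBall (xb i) δ) := by
    refine continuousOn_finsetSum _ fun i _ => continuousOn_finsetSum _ fun j _ => ?_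
    refine (hg i j).comp (f := fun y : Fin (p + l) → E2 => (y i, y j)) (by fun_prop)
      fun y hy => ⟨hy i trivial, hy j trivial⟩
  obtain ⟨τ, hτ, hnear⟩ := exists_pos_forall_dist_lt
    (isCompact_univ_pi fun i => isCompact_closedBall (xb i) δ) hWc
    (fun y hy hne => hmax y (fun i => hy i trivial) hne) (half_pos hη)
  obtain ⟨C, hC⟩ := exists_eventually_logEnergy_ge hδ hκ hg
  set s : Fin p → ℝ := fun i => κ (Fin.castAdd l i) ^ 2 / (4 * π) with hs
  have hs0 : ∀ i, 0 < s i := fun i => by have := hκ (Fin.castAdd l i); positivity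
  have hk0 : ∀ i : Fin p, 0 < |κ (Fin.castAdd l i)| := fun i => abs_pos.2 (hκ _)
  have hS0 : 0 ≤ ∑ i, s i := Finset.sum_nonneg fun i _ => (hs0 i).le
  set τA := τ / (4 * (∑ i, s i + 1)) with hτA
  set τB := τ / (4 * ((p + l : ℕ) ^ 2 + 1)) with hτB
  have hτA0 : 0 < τA := by positivity
  have hτB0 : 0 < τB := by positivity
  have hr_ev : ∀ᶠ r : ℝ in 𝓝[>] 0, 0 < r ∧ r * (1 + 2 * δ) < η / 2 ∧
      ∀ i j, ∀ (P Q : Measure E2) (a b : E2), IsProbabilityMeasure P →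
      IsProbabilityMeasure Q → P (closedBall (xb i) δ)ᶜ = 0 → Q (closedBall (xb j) δ)ᶜ = 0 →
      a ∈ closedBall (xb i) δ → b ∈ closedBall (xb j) δ →
      P.real {x | r ≤ dist x a} ≤ r → Q.real {x | r ≤ dist x b} ≤ r →
      |∫ q, g i j q ∂(P.prod Q) - g i j (a, b)| ≤ τB := by
    refine (eventually_mem_nhdsWithin.and ?_)
    refine Eventually.and ?_ (eventually_all.2 fun i => eventually_all.2 fun j =>
      eventually_abs_integral_prod_sub_le (isCompact_closedBall _ _) (isCompact_closedBall _ _)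
        (hg i j) hτB0)
    have : Tendsto (fun r : ℝ => r * (1 + 2 * δ)) (𝓝[>] 0) (𝓝 (0 * (1 + 2 * δ))) :=
      (tendsto_nhdsWithin_of_tendsto_nhds tendsto_id).mul_const _
    rw [zero_mul] at this
    exact this.eventually_lt_const (half_pos hη)
  obtain ⟨r, hr, hrη, hr3⟩ := hr_ev.exists
  set ρ := min r δ / 2 with hρ
  have hρ0 : 0 < ρ := by positivity
  have hρr : ρ < r := by have := min_le_left r δ; rw [hρ]; linarith
  have hρδ : ρ < δ := by have := min_le_right r δ; rw [hρ]; linarith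
  have hconc := fun i : Fin p => (tendsto_sqrt_div_atTop (hk0 i)).eventually
    ((eventually_exists_concentrated (C i) δ hr).and
      (eventually_exists_near_logEnergy_ge (C i) δ hρ0 hτA0))
  filter_upwards [eventually_gt_atTop 0, hC, eventually_all.2 hconc]
    with lam hlam hC hconc μ z hμ hmaxμ
  have hdens : ∀ i : Fin p, (√(|κ (Fin.castAdd l i)| / lam) ^ 2)⁻¹ = lam / |κ (Fin.castAdd l i)| :=
    fun i => inv_sq_sqrt_div (hk0 i) hlam
  have hE := hC μ z hμ hmaxμ
  have hle : ∀ i, μ i ≤ ENNReal.ofReal (√(|κ (Fin.castAdd l i)| / lam) ^ 2)⁻¹ • volume :=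
    fun i => by rw [hdens]; exact hμ.le i
  choose a ha hμa _ using fun i => (hconc i).1 (μ i) _ (hμ.isProb i) (hμ.null_closedBall i)
    (hle i) (hE i)
  choose ν hν1 hνK hνd hνE using fun i => (hconc i).2 (μ i) _ (xb (Fin.castAdd l i))
    (hμ.isProb i) (hμ.null_closedBall i) (hle i) (hE i)
  have hν : VortexAdmissible κ xb δ lam ν fun j => xb (Fin.natAdd p j) :=
    { isProb := hν1
      null := fun i => measure_mono_null (Set.compl_subset_compl.2
        (closedBall_subset_ball hρδ)) (hνK i)
      le := fun i => by rw [← hdens]; exact hνd i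
      mem := fun j => mem_closedBall_self hδ.le }
  have hνa : ∀ i, (ν i).real {x | r ≤ dist x (xb (Fin.castAdd l i))} ≤ r := fun i => by
    have hsub : {x | r ≤ dist x (xb (Fin.castAdd l i))} ⊆
        (closedBall (xb (Fin.castAdd l i)) ρ)ᶜ := by
      intro x hx
      simp only [Set.mem_ofPred_eq, Set.mem_compl_iff, mem_closedBall, not_le] at hx ⊢
      linarith
    have := measure_mono_null hsub (hνK i)
    simp [Measure.real, this, hr.le]
  have hcmp := hmaxμ _ _ hν
  have d1 := abs_le.1 (abs_interaction_sub_le hr hr3 hμ ha hμa)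
  have d2 := abs_le.1 (abs_interaction_sub_le hr hr3 hν
    (a := fun i => xb (Fin.castAdd l i)) (fun i => mem_closedBall_self hδ.le) hνa)
  have hxb : Fin.append (fun i => xb (Fin.castAdd l i)) (fun j => xb (Fin.natAdd p j)) = xb :=
    Fin.append_castAdd_natAdd
  rw [hxb] at d2
  unfold vortexEnergy at hcmp
  have hlow : ∑ i, s i * (logEnergy (μ i) - τA) ≤ ∑ i, s i * logEnergy (ν i) :=
    Finset.sum_le_sum fun i _ => mul_le_mul_of_nonneg_left (hνE i) (hs0 i).le
  simp only [mul_sub, Finset.sum_sub_distrib, ← Finset.sum_mul] at hlow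
  have e1 : (∑ i, s i) * τA ≤ τ / 4 := by
    rw [hτA, mul_div_assoc', div_le_div_iff₀ (by positivity) (by norm_num)]
    nlinarith
  have e2 : (p + l : ℕ) ^ 2 * τB ≤ τ / 4 := by
    rw [hτB, mul_div_assoc', div_le_div_iff₀ (by positivity) (by norm_num)]
    nlinarith
  have hmem : ∀ i, Fin.append a z i ∈ closedBall (xb i) δ := by
    refine Fin.addCases (fun i => ?_) (fun j => ?_)
    · simpa using ha i
    · simpa using hμ.mem j
  have hd := hnear (Fin.append a z) (fun i _ => hmem i) (by linarith)
  have hdi := fun i => (dist_le_pi_dist (Fin.append a z) xb i).trans_lt hd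
  refine ⟨fun i => ?_, fun j => ?_⟩
  · have h1 := hdi (Fin.castAdd l i)
    rw [Fin.append_left] at h1
    have := hμ.isProb i
    have h2 := dist_integral_le (hμ.null_closedBall i) (ha i) (hμa i) hδ.le hr.le
    have := dist_triangle (∫ x, x ∂(μ i)) (a i) (xb (Fin.castAdd l i))
    linarith
  · have h1 := hdi (Fin.natAdd p j)
    rw [Fin.append_right] at h1
    linarith

end Maximizers

/-- The normalization of the density `ω` by its mass `k` on `D`, as a measure. -/
def patchMeasure (D : Set E2) (k : ℝ) (ω : E2 → ℝ) : Measure E2 :=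
  (volume.restrict D).withDensity fun x => ENNReal.ofReal (ω x / k)

/-- A vortex patch of strength `k` supported in `ball c δ`, with vorticity bounded by `lam`. -/
structure IsPatch (D : Set E2) (c : E2) (δ lam k : ℝ) (ω : E2 → ℝ) : Prop where
  meas : Measurable ω
  supp : ∀ x, x ∉ ball c δ → ω x = 0
  mass : ∫ x in D, ω x = k
  bound : ∀ᵐ x : E2 ∂volume, 0 ≤ Real.sign k * ω x ∧ Real.sign k * ω x ≤ lam

namespace IsPatch

variable {D : Set E2} {c c' : E2} {δ lam k k' : ℝ} {ω ω' : E2 → ℝ}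

theorem ae_div (h : IsPatch D c δ lam k ω) (hk : k ≠ 0) :
    ∀ᵐ x : E2 ∂volume, 0 ≤ ω x / k ∧ ω x / k ≤ lam / |k| := by
  filter_upwards [h.bound] with x hx
  have hk' : 0 < |k| := abs_pos.2 hk
  have : ω x / k = Real.sign k * ω x / |k| := by
    rcases lt_or_gt_of_ne hk with hk | hk
    · rw [Real.sign_of_neg hk, abs_of_neg hk]
      field_simp
    · rw [Real.sign_of_pos hk, abs_of_pos hk, one_mul]
  rw [this]
  exact ⟨div_nonneg hx.1 hk'.le, div_le_div_of_nonneg_right hx.2 hk'.le⟩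

theorem integrable (h : IsPatch D c δ lam k ω) (hk : k ≠ 0) :
    Integrable ω (volume.restrict D) := by
  by_contra hi
  exact hk (h.mass.symm.trans (integral_undef hi))

theorem measurable_ofReal (h : IsPatch D c δ lam k ω) :
    Measurable fun x => ENNReal.ofReal (ω x / k) :=
  (h.meas.div_const k).ennreal_ofReal

theorem isProbabilityMeasure (h : IsPatch D c δ lam k ω) (hk : k ≠ 0) :
    IsProbabilityMeasure (patchMeasure D k ω) := by
  refine ⟨?_⟩
  rw [patchMeasure, withDensity_apply _ MeasurableSet.univ, Measure.restrict_univ,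
    ← ofReal_integral_eq_lintegral_ofReal ((h.integrable hk).div_const k)
      ((ae_restrict_of_ae (h.ae_div hk)).mono fun x hx => hx.1), integral_div, h.mass, div_self hk,
    ENNReal.ofReal_one]

theorem null (h : IsPatch D c δ lam k ω) : patchMeasure D k ω (ball c δ)ᶜ = 0 := by
  rw [patchMeasure, withDensity_apply _ measurableSet_ball.compl]
  refine (setLIntegral_congr_fun measurableSet_ball.compl (g := fun _ => 0) fun x hx => ?_).trans
    (by simp)
  simp [h.supp x hx]

theorem le (h : IsPatch D c δ lam k ω) (hk : k ≠ 0) :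
    patchMeasure D k ω ≤ ENNReal.ofReal (lam / |k|) • volume := by
  have h1 : patchMeasure D k ω ≤ (volume.restrict D).withDensity fun _ =>
      ENNReal.ofReal (lam / |k|) :=
    withDensity_mono ((ae_restrict_of_ae (h.ae_div hk)).mono fun x hx =>
      ENNReal.ofReal_le_ofReal hx.2)
  rw [withDensity_const] at h1
  refine h1.trans fun s => ?_
  simp only [Measure.smul_apply, smul_eq_mul]
  gcongr
  exact Measure.restrict_le_self

theorem integral_eq {F : Type*} [NormedAddCommGroup F] [NormedSpace ℝ F]
    (h : IsPatch D c δ lam k ω) (hk : k ≠ 0) (f : E2 → F) :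
    ∫ x, f x ∂(patchMeasure D k ω) = k⁻¹ • ∫ x in D, ω x • f x := by
  rw [patchMeasure, integral_withDensity_eq_integral_toReal_smul h.measurable_ofReal
    (by simp), ← integral_smul]
  refine integral_congr_ae ((ae_restrict_of_ae (h.ae_div hk)).mono fun x hx => ?_)
  simp only [ENNReal.toReal_ofReal hx.1, smul_smul]
  rw [div_eq_inv_mul]

theorem integrable_mul (h : IsPatch D c δ lam k ω) (hk : k ≠ 0) {f : E2 → ℝ}
    (hf : Integrable f (patchMeasure D k ω)) :
    Integrable (fun x => f x * ω x) (volume.restrict D) := by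
  rw [patchMeasure, integrable_withDensity_iff_integrable_smul' h.measurable_ofReal
    (by simp)] at hf
  refine (hf.const_mul k).congr ((ae_restrict_of_ae (h.ae_div hk)).mono fun x hx => ?_)
  simp only [ENNReal.toReal_ofReal hx.1, smul_eq_mul]
  field_simp

theorem prod_eq (h : IsPatch D c δ lam k ω) (h' : IsPatch D c' δ lam k' ω') :
    (patchMeasure D k ω).prod (patchMeasure D k' ω') =
      ((volume.restrict D).prod (volume.restrict D)).withDensity
        fun q => ENNReal.ofReal (ω q.1 / k) * ENNReal.ofReal (ω' q.2 / k') :=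
  prod_withDensity h.measurable_ofReal h'.measurable_ofReal

theorem ae_prod_toReal (h : IsPatch D c δ lam k ω) (h' : IsPatch D c' δ lam k' ω') (hk : k ≠ 0)
    (hk' : k' ≠ 0) : ∀ᵐ q : E2 × E2 ∂((volume.restrict D).prod (volume.restrict D)),
      (ENNReal.ofReal (ω q.1 / k) * ENNReal.ofReal (ω' q.2 / k')).toReal =
        (k * k')⁻¹ * (ω q.1 * ω' q.2) := by
  filter_upwards [Measure.quasiMeasurePreserving_fst.ae (ae_restrict_of_ae (h.ae_div hk)),
    Measure.quasiMeasurePreserving_snd.ae (ae_restrict_of_ae (h'.ae_div hk'))] with q h1 h2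
  rw [ENNReal.toReal_mul, ENNReal.toReal_ofReal h1.1, ENNReal.toReal_ofReal h2.1]
  field_simp

theorem integral_prod_eq (h : IsPatch D c δ lam k ω) (h' : IsPatch D c' δ lam k' ω') (hk : k ≠ 0)
    (hk' : k' ≠ 0) {f : E2 × E2 → ℝ}
    (hf : Integrable f ((patchMeasure D k ω).prod (patchMeasure D k' ω'))) :
    Integrable (fun q => f q * ω q.1 * ω' q.2)
      ((volume.restrict D).prod (volume.restrict D)) ∧
    ∫ q, f q * ω q.1 * ω' q.2 ∂((volume.restrict D).prod (volume.restrict D)) =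
      k * k' * ∫ q, f q ∂((patchMeasure D k ω).prod (patchMeasure D k' ω')) := by
  have hm : Measurable fun q : E2 × E2 =>
      ENNReal.ofReal (ω q.1 / k) * ENNReal.ofReal (ω' q.2 / k') :=
    (h.measurable_ofReal.comp measurable_fst).mul (h'.measurable_ofReal.comp measurable_snd)
  have hfin : ∀ᵐ q : E2 × E2 ∂((volume.restrict D).prod (volume.restrict D)),
      ENNReal.ofReal (ω q.1 / k) * ENNReal.ofReal (ω' q.2 / k') < ∞ :=
    Eventually.of_forall fun q => ENNReal.mul_lt_top ENNReal.ofReal_lt_top ENNReal.ofReal_lt_top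
  have hkk : k * k' ≠ 0 := mul_ne_zero hk hk'
  rw [h.prod_eq h'] at hf ⊢
  rw [integrable_withDensity_iff_integrable_smul' hm hfin] at hf
  have hae := h.ae_prod_toReal h' hk hk'
  constructor
  · refine (hf.const_mul (k * k')).congr (hae.mono fun q hq => ?_)
    simp only [hq, smul_eq_mul]
    field_simp
  · rw [integral_withDensity_eq_integral_toReal_smul hm hfin, ← integral_const_mul]
    refine integral_congr_ae (hae.mono fun q hq => ?_)
    simp only [hq, smul_eq_mul]
    field_simp

end IsPatch

theorem exists_isPatch {D : Set E2} {c : E2} {δ lam k : ℝ}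
    (hball : ball c δ ⊆ D) (hk : k ≠ 0) (hlam : 0 ≤ lam) {ν : Measure E2}
    [IsProbabilityMeasure ν] (hν : ν (ball c δ)ᶜ = 0)
    (hle : ν ≤ ENNReal.ofReal (lam / |k|) • volume) :
    ∃ ω, IsPatch D c δ lam k ω ∧ patchMeasure D k ω = ν := by
  have hac : ν ≪ volume := Measure.absolutelyContinuous_of_le_smul hle
  have hk' : 0 < |k| := abs_pos.2 hk
  have hrn := Measure.withDensity_rnDeriv_eq ν volume hac
  have hrm := Measure.measurable_rnDeriv ν volume
  have hbd : ∀ᵐ x : E2 ∂volume, ν.rnDeriv volume x ≤ ENNReal.ofReal (lam / |k|) := by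
    refine ae_le_of_forall_setLIntegral_le_of_sigmaFinite hrm fun s hs _ => ?_
    rw [← withDensity_apply _ hs, hrn, setLIntegral_const]
    exact hle s
  set ω : E2 → ℝ := (ball c δ).indicator fun x => k * (ν.rnDeriv volume x).toReal with hω
  have hωm : Measurable ω :=
    (hrm.ennreal_toReal.const_mul k).indicator measurableSet_ball
  have hωd : ∀ x, ENNReal.ofReal (ω x / k) =
      (ball c δ).indicator (fun x => ENNReal.ofReal (ν.rnDeriv volume x).toReal) x := fun x => by
    by_cases hx : x ∈ ball c δ
    · simp [hω, hx, mul_div_cancel_left₀ _ hk]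
    · simp [hω, hx]
  have hpatch : patchMeasure D k ω = ν := by
    rw [patchMeasure]
    simp only [hωd]
    rw [withDensity_indicator measurableSet_ball, Measure.restrict_restrict measurableSet_ball,
      Set.inter_eq_left.2 hball]
    have : (fun x => ENNReal.ofReal (ν.rnDeriv volume x).toReal) =ᵐ[volume.restrict (ball c δ)]
        ν.rnDeriv volume := by
      filter_upwards [ae_restrict_of_ae hbd] with x hx
      exact ENNReal.ofReal_toReal (hx.trans_lt ENNReal.ofReal_lt_top).ne
    rw [withDensity_congr_ae this, ← restrict_withDensity measurableSet_ball, hrn]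
    exact Measure.restrict_eq_self_of_ae_mem (mem_ae_iff.2 hν)
  refine ⟨ω, ⟨hωm, fun x hx => by simp [hω, hx], ?_, ?_⟩, hpatch⟩
  · have h1 : ∫ x in D, ω x / k = 1 := by
      rw [integral_eq_lintegral_of_nonneg_ae _ (hωm.div_const k).aestronglyMeasurable]
      · have : (∫⁻ x in D, ENNReal.ofReal (ω x / k)) = 1 := by
          rw [← setLIntegral_univ, ← withDensity_apply _ MeasurableSet.univ]
          change patchMeasure D k ω Set.univ = 1
          rw [hpatch, measure_univ]
        rw [this, ENNReal.toReal_one]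
      · refine Eventually.of_forall fun x => ?_
        by_cases hx : x ∈ ball c δ
        · simp [hω, hx, mul_div_cancel_left₀ _ hk]
        · simp [hω, hx]
    rw [integral_div] at h1
    field_simp at h1
    exact h1
  · filter_upwards [hbd] with x hx
    by_cases hxb : x ∈ ball c δ
    · have h1 : (ν.rnDeriv volume x).toReal ≤ lam / |k| := ENNReal.toReal_le_of_le_ofReal
        (by positivity) hx
      rw [le_div_iff₀ hk'] at h1
      have h2 : Real.sign k * ω x = (ν.rnDeriv volume x).toReal * |k| := by
        simp only [hω, Set.indicator_of_mem hxb]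
        rcases lt_or_gt_of_ne hk with hk | hk
        · rw [Real.sign_of_neg hk, abs_of_neg hk]
          ring
        · rw [Real.sign_of_pos hk, abs_of_pos hk]
          ring
      rw [h2]
      exact ⟨by positivity, h1⟩
    · simp [hω, hxb, hlam]

theorem ContinuousOn.integrable_of_isCompact {K : Set E2} (hK : IsCompact K) {f : E2 → ℝ}
    (hf : ContinuousOn f K) {P : Measure E2} [IsProbabilityMeasure P] (hP : P Kᶜ = 0) :
    Integrable f P := by
  have h := hf.integrableOn_compact (μ := P) hK
  rwa [IntegrableOn, Measure.restrict_eq_self_of_ae_mem (mem_ae_iff.2 hP)] at h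

/-- The pairwise interaction of vortices, with the singular self-interaction removed. -/
def vortexInteraction {n : ℕ} (κ : Fin n → ℝ) (G h : E2 → E2 → ℝ) (i j : Fin n) (q : E2 × E2) : ℝ :=
  if i = j then -κ i ^ 2 * h q.1 q.2 else κ i * κ j * G q.1 q.2

theorem continuousOn_green {D : Set E2} {h G : E2 → E2 → ℝ}
    (hcont : ContinuousOn (fun q : E2 × E2 => h q.1 q.2) (D ×ˢ D))
    (hG : ∀ x y, G x y = (1 / (2 * π)) * Real.log (1 / dist x y) - h x y) {A B : Set E2}
    (hA : A ⊆ D) (hB : B ⊆ D) (hAB : Disjoint A B) :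
    ContinuousOn (fun q : E2 × E2 => G q.1 q.2) (A ×ˢ B) := by
  simp only [hG]
  have hne : ∀ q ∈ A ×ˢ B, dist q.1 q.2 ≠ 0 := fun q hq h0 =>
    Set.disjoint_left.1 hAB hq.1 ((dist_eq_zero.1 h0).symm ▸ hq.2)
  refine (continuousOn_const.mul (ContinuousOn.log ?_ fun q hq => ?_)).sub
    (hcont.mono (Set.prod_mono hA hB))
  · exact continuousOn_const.div (by fun_prop) hne
  · exact one_div_ne_zero (hne q hq)

theorem continuousOn_vortexInteraction {n : ℕ} {D : Set E2} {h G : E2 → E2 → ℝ}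
    (hcont : ContinuousOn (fun q : E2 × E2 => h q.1 q.2) (D ×ˢ D))
    (hG : ∀ x y, G x y = (1 / (2 * π)) * Real.log (1 / dist x y) - h x y) (κ : Fin n → ℝ)
    {A : Fin n → Set E2} (hA : ∀ i, A i ⊆ D) (hdisj : ∀ i j, i ≠ j → Disjoint (A i) (A j))
    (i j : Fin n) : ContinuousOn (vortexInteraction κ G h i j) (A i ×ˢ A j) := by
  by_cases hij : i = j
  · have : vortexInteraction κ G h i j = fun q => -κ i ^ 2 * h q.1 q.2 := by
      ext q
      simp [vortexInteraction, hij]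
    rw [this]
    exact continuousOn_const.mul (hcont.mono (Set.prod_mono (hA i) (hA j)))
  · have : vortexInteraction κ G h i j = fun q => κ i * κ j * G q.1 q.2 := by
      ext q
      simp [vortexInteraction, hij]
    rw [this]
    exact continuousOn_const.mul (continuousOn_green hcont hG (hA i) (hA j) (hdisj i j hij))

theorem integrable_green_self {D : Set E2} {h G : E2 → E2 → ℝ}
    (hcont : ContinuousOn (fun q : E2 × E2 => h q.1 q.2) (D ×ˢ D))
    (hG : ∀ x y, G x y = (1 / (2 * π)) * Real.log (1 / dist x y) - h x y) {c : E2} {δ ε : ℝ}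
    (hc : closedBall c δ ⊆ D) {P : Measure E2} [IsProbabilityMeasure P]
    (hP : P (closedBall c δ)ᶜ = 0) (hε : 0 < ε)
    (hle : P ≤ ENNReal.ofReal (ε ^ 2)⁻¹ • volume) :
    Integrable (fun q : E2 × E2 => G q.1 q.2) (P.prod P) ∧
      ∫ q, G q.1 q.2 ∂(P.prod P) =
        1 / (2 * π) * logEnergy P - ∫ q, h q.1 q.2 ∂(P.prod P) := by
  have h1 := (integrable_log_one_div_dist hP hε hle).const_mul (1 / (2 * π))
  have h2 := (hcont.mono (Set.prod_mono hc hc)).integrable_prod_of_isCompact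
    (isCompact_closedBall _ _) (isCompact_closedBall _ _) hP hP
  simp only [hG]
  refine ⟨h1.sub h2, ?_⟩
  rw [integral_sub h1 h2, integral_const_mul, logEnergy]

theorem energy_eq_vortexEnergy {p l : ℕ} {D : Set E2} {h G : E2 → E2 → ℝ}
    (hcont : ContinuousOn (fun q : E2 × E2 => h q.1 q.2) (D ×ˢ D))
    (hsymm : ∀ x ∈ D, ∀ y ∈ D, h x y = h y x)
    (hG : ∀ x y, G x y = (1 / (2 * π)) * Real.log (1 / dist x y) - h x y)
    {κ : Fin (p + l) → ℝ} (hκ : ∀ i, κ i ≠ 0) {xb : Fin (p + l) → E2} {δ lam : ℝ} (hlam : 0 < lam)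
    (hball : ∀ i, closedBall (xb i) δ ⊆ D)
    (hdisj : ∀ i j, i ≠ j → Disjoint (closedBall (xb i) δ) (closedBall (xb j) δ))
    {ω : Fin p → E2 → ℝ} {z : Fin l → E2}
    (hω : ∀ i, IsPatch D (xb (Fin.castAdd l i)) δ lam (κ (Fin.castAdd l i)) (ω i))
    (hz : ∀ j, z j ∈ closedBall (xb (Fin.natAdd p j)) δ) :
    1 / 2 * (∫ x in D, ∫ y in D, G x y * (∑ i, ω i) x * (∑ i, ω i) y)
      + ∑ j, κ (Fin.natAdd p j) * (∫ y in D, G (z j) y * (∑ i, ω i) y)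
      + 1 / 2 * ∑ i, ∑ j ∈ Finset.univ.filter (fun j => j ≠ i),
          κ (Fin.natAdd p i) * κ (Fin.natAdd p j) * G (z i) (z j)
      - ∑ j, κ (Fin.natAdd p j) ^ 2 * (1 / 2 * h (z j) (z j)) =
    vortexEnergy κ (vortexInteraction κ G h)
      (fun i => patchMeasure D (κ (Fin.castAdd l i)) (ω i)) z := by
  set P : Fin p → Measure E2 := fun i => patchMeasure D (κ (Fin.castAdd l i)) (ω i) with hPdef
  have hadm : VortexAdmissible κ xb δ lam P z :=
    ⟨fun i => (hω i).isProbabilityMeasure (hκ _), fun i => (hω i).null,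
      fun i => (hω i).le (hκ _), hz⟩
  have hprob := hadm.isProb
  have hnull := hadm.null_closedBall
  have hg := continuousOn_vortexInteraction hcont hG κ hball hdisj
  have hGs : ∀ x ∈ D, ∀ y ∈ D, G x y = G y x := fun x hx y hy => by
    rw [hG, hG, dist_comm, hsymm x hx y hy]
  have hk0 : ∀ i : Fin p, 0 < |κ (Fin.castAdd l i)| := fun i => abs_pos.2 (hκ _)
  have hself := fun i : Fin p => integrable_green_self hcont hG (hball (Fin.castAdd l i))
    (hnull i) (sqrt_pos.2 (div_pos (hk0 i) hlam))
    (by rw [inv_sq_sqrt_div (hk0 i) hlam]; exact hadm.le i)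
  have hGi : ∀ i j, Integrable (fun q : E2 × E2 => G q.1 q.2) ((P i).prod (P j)) := fun i j => by
    by_cases hij : i = j
    · subst hij
      exact (hself i).1
    · exact (continuousOn_green hcont hG (hball (Fin.castAdd l i)) (hball (Fin.castAdd l j))
        (hdisj _ _ (by simpa using hij))).integrable_prod_of_isCompact (isCompact_closedBall _ _)
        (isCompact_closedBall _ _) (hnull i) (hnull j)
  have hne : ∀ (i : Fin p) (j : Fin l), Fin.castAdd l i ≠ Fin.natAdd p j := fun i j hij => by
    have := congrArg Fin.val hij
    simp only [Fin.val_castAdd, Fin.val_natAdd] at this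
    omega
  have hGz : ∀ i j, Integrable (fun y => G (z j) y) (P i) := fun i j =>
    ((continuousOn_green hcont hG (hball (Fin.natAdd p j)) (hball (Fin.castAdd l i))
      (hdisj _ _ (hne i j).symm)).comp (f := fun y => (z j, y)) (by fun_prop)
      fun y hy => ⟨hz j, hy⟩).integrable_of_isCompact (isCompact_closedBall _ _) (hnull i)
  have hEn : (∫ x in D, ∫ y in D, G x y * (∑ i, ω i) x * (∑ i, ω i) y) =
      ∑ i, ∑ j, κ (Fin.castAdd l i) * κ (Fin.castAdd l j) *
        ∫ q, G q.1 q.2 ∂((P i).prod (P j)) := by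
    have hp := fun i j => (hω i).integral_prod_eq (hω j) (hκ _) (hκ _) (hGi i j)
    have hsum : (fun q : E2 × E2 => G q.1 q.2 * (∑ i, ω i) q.1 * (∑ i, ω i) q.2) =
        fun q => ∑ i, ∑ j, G q.1 q.2 * ω i q.1 * ω j q.2 := by
      ext q
      simp only [Finset.sum_apply, Finset.mul_sum, Finset.sum_mul]
      exact Finset.sum_comm
    have hGint : Integrable (fun q : E2 × E2 => G q.1 q.2 * (∑ i, ω i) q.1 * (∑ i, ω i) q.2)
        ((volume.restrict D).prod (volume.restrict D)) := by
      rw [hsum]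
      exact integrable_finsetSum _ fun i _ => integrable_finsetSum _ fun j _ => (hp i j).1
    rw [← integral_prod _ hGint, hsum, integral_finsetSum _ fun i _ =>
      integrable_finsetSum _ fun j _ => (hp i j).1]
    refine Finset.sum_congr rfl fun i _ => ?_
    rw [integral_finsetSum _ fun j _ => (hp i j).1]
    exact Finset.sum_congr rfl fun j _ => (hp i j).2
  have hψ : ∀ j, (∫ y in D, G (z j) y * (∑ i, ω i) y) =
      ∑ i, κ (Fin.castAdd l i) * ∫ y, G (z j) y ∂(P i) := fun j => by
    simp only [Finset.sum_apply, Finset.mul_sum]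
    rw [integral_finsetSum _ fun i _ => (hω i).integrable_mul (hκ _) (hGz i j)]
    refine Finset.sum_congr rfl fun i _ => ?_
    rw [(hω i).integral_eq (hκ _), smul_eq_mul, mul_inv_cancel_left₀ (hκ _)]
    simp only [smul_eq_mul, mul_comm]
  have hgi : ∀ i j, ∫ q, vortexInteraction κ G h i j q ∂((vortexLaw P z i).prod (vortexLaw P z j)) =
      ∫ x, ∫ y, vortexInteraction κ G h i j (x, y) ∂(vortexLaw P z j) ∂(vortexLaw P z i) :=
    fun i j => by
      have := hadm.isProbabilityMeasure i
      have := hadm.isProbabilityMeasure j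
      exact integral_prod _ ((hg i j).integrable_prod_of_isCompact (isCompact_closedBall _ _)
        (isCompact_closedBall _ _) (hadm.law_null i) (hadm.law_null j))
  have hl : ∀ i, vortexLaw P z (Fin.castAdd l i) = P i := fun i => Fin.append_left _ _ i
  have hr : ∀ j, vortexLaw P z (Fin.natAdd p j) = Measure.dirac (z j) :=
    fun j => Fin.append_right _ _ j
  have hpp : ∀ i j, ∫ q, vortexInteraction κ G h (Fin.castAdd l i) (Fin.castAdd l j) q
      ∂((vortexLaw P z (Fin.castAdd l i)).prod (vortexLaw P z (Fin.castAdd l j))) =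
      κ (Fin.castAdd l i) * κ (Fin.castAdd l j) * ∫ q, G q.1 q.2 ∂((P i).prod (P j)) -
        if i = j then κ (Fin.castAdd l i) ^ 2 / (2 * π) * logEnergy (P i) else 0 := fun i j => by
    rw [hl, hl]
    by_cases hij : i = j
    · subst hij
      simp only [vortexInteraction, if_true]
      rw [integral_const_mul, (hself i).2]
      field_simp
      ring
    · simp only [vortexInteraction, Fin.castAdd_inj, hij, if_false]
      rw [integral_const_mul, sub_zero]
  have hvp : ∀ j i, ∫ q, vortexInteraction κ G h (Fin.natAdd p j) (Fin.castAdd l i) q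
      ∂((vortexLaw P z (Fin.natAdd p j)).prod (vortexLaw P z (Fin.castAdd l i))) =
      κ (Fin.natAdd p j) * (κ (Fin.castAdd l i) * ∫ y, G (z j) y ∂(P i)) := fun j i => by
    rw [hgi, hl, hr, integral_dirac]
    simp only [vortexInteraction, (hne i j).symm, if_false]
    rw [integral_const_mul, mul_assoc]
  have hpv : ∀ i j, ∫ q, vortexInteraction κ G h (Fin.castAdd l i) (Fin.natAdd p j) q
      ∂((vortexLaw P z (Fin.castAdd l i)).prod (vortexLaw P z (Fin.natAdd p j))) =
      κ (Fin.natAdd p j) * (κ (Fin.castAdd l i) * ∫ y, G (z j) y ∂(P i)) := fun i j => by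
    rw [hgi, hl, hr]
    simp only [integral_dirac, vortexInteraction, hne i j, if_false]
    rw [integral_const_mul, mul_comm (κ (Fin.castAdd l i)), mul_assoc]
    congr 2
    refine integral_congr_ae ?_
    filter_upwards [mem_ae_iff.2 (hnull i)] with x hx
    exact hGs x (hball _ hx) _ (hball _ (hz j))
  have hvv : ∀ i j, ∫ q, vortexInteraction κ G h (Fin.natAdd p i) (Fin.natAdd p j) q
      ∂((vortexLaw P z (Fin.natAdd p i)).prod (vortexLaw P z (Fin.natAdd p j))) =
      (if j ≠ i then κ (Fin.natAdd p i) * κ (Fin.natAdd p j) * G (z i) (z j) else 0) -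
        if i = j then κ (Fin.natAdd p i) ^ 2 * h (z i) (z i) else 0 := fun i j => by
    rw [hgi, hr, hr, integral_dirac, integral_dirac]
    by_cases hij : i = j
    · subst hij
      simp [vortexInteraction]
    · simp [vortexInteraction, hij, Ne.symm hij]
  rw [vortexEnergy, hEn]
  simp only [Fin.sum_univ_add, hpp, hpv, hvp, hvv, hψ, Finset.sum_add_distrib,
    Finset.sum_sub_distrib, Finset.sum_ite_eq, Finset.mem_univ, if_true, Finset.sum_filter]
  rw [Finset.sum_comm (f := fun (i : Fin p) (j : Fin l) =>
    κ (Fin.natAdd p j) * (κ (Fin.castAdd l i) * ∫ y, G (z j) y ∂(P i)))]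
  simp only [← Finset.mul_sum, mul_left_comm _ (1 / 2 : ℝ)]
  have hlog : ∑ i, κ (Fin.castAdd l i) ^ 2 / (2 * π) * logEnergy (P i) =
      2 * ∑ i, κ (Fin.castAdd l i) ^ 2 / (4 * π) * logEnergy (P i) := by
    rw [Finset.mul_sum]
    refine Finset.sum_congr rfl fun i _ => ?_
    field_simp
    ring
  rw [hlog]
  ring

theorem convergence_of_centers
    (p l : ℕ) (hp : 0 < p) (hl : 0 < l)
    (D : Set E2) (hDopen : IsOpen D) (hDbdd : Bornology.IsBounded D)
    (hDsc : SimplyConnectedSpace D)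
    (h : E2 → E2 → ℝ)
    (hcont : ContinuousOn (fun q : E2 × E2 => h q.1 q.2) (D ×ˢ D))
    (hsymm : ∀ x ∈ D, ∀ y ∈ D, h x y = h y x)
    (hharm : ∀ y ∈ D, ContDiffOn ℝ 2 (fun x => h x y) D ∧
      ∀ x ∈ D, ∑ i : Fin 2,
        iteratedFDerivWithin ℝ 2 (fun x' => h x' y) D x
          ![EuclideanSpace.single i 1, EuclideanSpace.single i 1] = 0)
    (G : E2 → E2 → ℝ)
    (hG : ∀ x y, G x y = (1 / (2 * π)) * Real.log (1 / dist x y) - h x y)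
    (hGbdry : ∀ y ∈ D, ∀ z ∈ frontier D,
      Tendsto (fun x => G x y) (𝓝[D] z) (𝓝 0))
    (κ : Fin (p + l) → ℝ) (hκ : ∀ i, κ i ≠ 0)
    (xb : Fin (p + l) → E2) (hxbD : ∀ i, xb i ∈ D) (hxbinj : Function.Injective xb)
    (δ0 : ℝ) (hδ0 : 0 < δ0)
    (hball : ∀ i, closedBall (xb i) δ0 ⊆ D)
    (hdisj : ∀ i j, i ≠ j → Disjoint (closedBall (xb i) δ0) (closedBall (xb j) δ0))
    (KR : (Fin (p + l) → E2) → ℝ)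
    (hKR : ∀ y, KR y =
      -(∑ i, ∑ j ∈ Finset.univ.filter (fun j => j ≠ i), κ i * κ j * G (y i) (y j))
      + ∑ i, (κ i) ^ 2 * h (y i) (y i))
    (hmin : ∀ y : Fin (p + l) → E2, (∀ i, y i ∈ closedBall (xb i) δ0) →
      Function.Injective y → y ≠ xb → KR xb < KR y)
    (ψ : (E2 → ℝ) → E2 → ℝ)
    (hψ : ∀ ω x, ψ ω x = ∫ y in D, G x y * ω y)
    (En : (E2 → ℝ) → ℝ)
    (hEn : ∀ ω, En ω = (1 / 2) * ∫ x in D, ∫ y in D, G x y * ω x * ω y)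
    (EE : (E2 → ℝ) → (Fin l → E2) → ℝ)
    (hEE : ∀ ω z, EE ω z = En ω
      + ∑ j, κ (Fin.natAdd p j) * ψ ω (z j)
      + (1 / 2) * ∑ i, ∑ j ∈ Finset.univ.filter (fun j => j ≠ i),
          κ (Fin.natAdd p i) * κ (Fin.natAdd p j) * G (z i) (z j)
      - ∑ j, (κ (Fin.natAdd p j)) ^ 2 * ((1 / 2) * h (z j) (z j)))
    (Adm : ℝ → ℝ → (Fin p → E2 → ℝ) → Prop)
    (hAdm : ∀ δ lam ωs, Adm δ lam ωs ↔ ∀ i : Fin p,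
      Measurable (ωs i)
      ∧ (∀ x, x ∉ ball (xb (Fin.castAdd l i)) δ → ωs i x = 0)
      ∧ (∫ x in D, ωs i x) = κ (Fin.castAdd l i)
      ∧ (∀ᵐ x : E2 ∂volume, 0 ≤ Real.sign (κ (Fin.castAdd l i)) * ωs i x
          ∧ Real.sign (κ (Fin.castAdd l i)) * ωs i x ≤ lam))
    (δ : ℝ) (hδ : 0 < δ) (hδ2 : δ < δ0 / 2)
    (hbdry : ∀ lam, 0 < lam → ∀ (ωs : Fin p → E2 → ℝ) (z : Fin l → E2),
      Adm δ lam ωs ∧ (∀ j, z j ∈ closedBall (xb (Fin.natAdd p j)) δ) ∧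
      (∀ (ωs' : Fin p → E2 → ℝ) (z' : Fin l → E2), Adm δ lam ωs' →
        (∀ j, z' j ∈ closedBall (xb (Fin.natAdd p j)) δ) →
        EE (∑ i, ωs' i) z' ≤ EE (∑ i, ωs i) z) →
      ∀ i : Fin p, ∀ x ∈ sphere (xb (Fin.castAdd l i)) δ0,
        Real.sign (κ (Fin.castAdd l i)) * (ψ (∑ i', ωs i') x + ∑ j, κ (Fin.natAdd p j) * G (z j) x) ≤
        essInf (fun x => Real.sign (κ (Fin.castAdd l i)) * (ψ (∑ i', ωs i') x + ∑ j, κ (Fin.natAdd p j) * G (z j) x))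
        (volume.restrict {x ∈ ball (xb (Fin.castAdd l i)) δ | 0 < Real.sign (κ (Fin.castAdd l i)) * ωs i x}))
    :
    ∀ η > 0, ∃ lam0 > 0, ∀ lam, lam0 < lam →
      ∀ (ωs : Fin p → E2 → ℝ) (z : Fin l → E2),
      (Adm δ lam ωs ∧ (∀ j, z j ∈ closedBall (xb (Fin.natAdd p j)) δ) ∧
      (∀ (ωs' : Fin p → E2 → ℝ) (z' : Fin l → E2), Adm δ lam ωs' →
        (∀ j, z' j ∈ closedBall (xb (Fin.natAdd p j)) δ) →
        EE (∑ i, ωs' i) z' ≤ EE (∑ i, ωs i) z)) →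
      (∀ i : Fin p,
        dist ((κ (Fin.castAdd l i))⁻¹ • ∫ x in D, ωs i x • x) (xb (Fin.castAdd l i)) < η) ∧
      (∀ j : Fin l, dist (z j) (xb (Fin.natAdd p j)) < η) := by
  intro η hη
  have hδδ0 : δ ≤ δ0 := by linarith
  have hsub : ∀ i, closedBall (xb i) δ ⊆ closedBall (xb i) δ0 :=
    fun i => closedBall_subset_closedBall hδδ0
  have hballδ : ∀ i, closedBall (xb i) δ ⊆ D := fun i => (hsub i).trans (hball i)
  have hdisjδ : ∀ i j, i ≠ j → Disjoint (closedBall (xb i) δ) (closedBall (xb j) δ) :=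
    fun i j hij => (hdisj i j hij).mono (hsub i) (hsub j)
  have hKRg : ∀ y, ∑ i, ∑ j, vortexInteraction κ G h i j (y i, y j) = -KR y := fun y => by
    have : ∀ i j, vortexInteraction κ G h i j (y i, y j) =
        (if j ≠ i then κ i * κ j * G (y i) (y j) else 0) -
          if i = j then κ i ^ 2 * h (y i) (y i) else 0 := fun i j => by
      by_cases hij : i = j
      · subst hij
        simp [vortexInteraction]
      · simp [vortexInteraction, hij, Ne.symm hij]
    simp only [this, hKR, Finset.sum_sub_distrib, Finset.sum_ite_eq, Finset.mem_univ, if_true,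
      Finset.sum_filter]
    ring
  have hmax : ∀ y : Fin (p + l) → E2, (∀ i, y i ∈ closedBall (xb i) δ) → y ≠ xb →
      ∑ i, ∑ j, vortexInteraction κ G h i j (y i, y j) <
        ∑ i, ∑ j, vortexInteraction κ G h i j (xb i, xb j) := fun y hy hne => by
    rw [hKRg, hKRg, neg_lt_neg_iff]
    refine hmin y (fun i => hsub i (hy i)) (fun i j hij => ?_) hne
    by_contra hne'
    exact Set.disjoint_left.1 (hdisjδ i j hne') (hy i) (hij ▸ hy j)
  have hAdm' : ∀ lam ωs, Adm δ lam ωs ↔ ∀ i : Fin p,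
      IsPatch D (xb (Fin.castAdd l i)) δ lam (κ (Fin.castAdd l i)) (ωs i) := fun lam ωs => by
    rw [hAdm]
    exact forall_congr' fun i => ⟨fun h => ⟨h.1, h.2.1, h.2.2.1, h.2.2.2⟩,
      fun h => ⟨h.meas, h.supp, h.mass, h.bound⟩⟩
  have hEE' : ∀ {lam ωs z}, 0 < lam → Adm δ lam ωs →
      (∀ j, z j ∈ closedBall (xb (Fin.natAdd p j)) δ) →
      EE (∑ i, ωs i) z = vortexEnergy κ (vortexInteraction κ G h)
        (fun i => patchMeasure D (κ (Fin.castAdd l i)) (ωs i)) z := fun hlam hω hz => by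
    rw [hEE, hEn]
    simp only [hψ]
    exact energy_eq_vortexEnergy hcont hsymm hG hκ hlam hballδ hdisjδ ((hAdm' _ _).1 hω) hz
  obtain ⟨lam1, hlam1⟩ := eventually_atTop.1 (eventually_maximizers_near hδ hκ
    (continuousOn_vortexInteraction hcont hG κ hballδ hdisjδ) hmax hη)
  refine ⟨max lam1 1, by positivity, fun lam hlam ωs z ⟨hω, hz, hopt⟩ => ?_⟩
  have hlam0 : 0 < lam := one_pos.trans ((le_max_right _ _).trans_lt hlam)
  have hpatch := (hAdm' _ _).1 hω
  have hres := hlam1 lam ((le_max_left _ _).trans hlam.le)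
    (fun i => patchMeasure D (κ (Fin.castAdd l i)) (ωs i)) z
    ⟨fun i => (hpatch i).isProbabilityMeasure (hκ _), fun i => (hpatch i).null,
      fun i => (hpatch i).le (hκ _), hz⟩ fun ν z' hν => by
    have hex := fun i => by
      have := hν.isProb i
      exact exists_isPatch (ball_subset_closedBall.trans (hballδ (Fin.castAdd l i))) (hκ _)
        hlam0.le (hν.null i) (hν.le i)
    choose ω' hω' hν' using hex
    have hadm' := (hAdm' lam ω').2 hω'
    have hle := hopt ω' z' hadm' hν.mem
    rw [hEE' hlam0 hadm' hν.mem, hEE' hlam0 hω hz] at hle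
    simpa only [hν'] using hle
  refine ⟨fun i => ?_, hres.2⟩
  have := hres.1 i
  rwa [(hpatch i).integral_eq (hκ _)] at this
end
end
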